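/- Let A be a separable, unital C*-algebra with real rank zero and nuclear dimension at most one. Then there exists a positive contraction h in A_∞ ∩ A′ (the relative commutant of the diagonal copy of A in the sequence algebra A_∞) and sequences (C_n) and (D_n) of finite-dimensional C*-subalgebras of A such that h·a ∈ C_∞ and (1 − h)·a ∈ D_∞ for all a ∈ A, where C_∞ and D_∞ denote the C*-subalgebras of A_∞ given by the images of the products ∏_n C_n and ∏_n D_n. -/

import Mathlib

universe u v

open Filter Topology

/-- A square matrix over a C*-algebra (or star ring) is positive iff it has the form
`star y * y`. -/
def MatIsPos {R : Type*} [NonUnitalSemiring R] [StarRing R] {k : ℕ}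
    (x : Matrix (Fin k) (Fin k) R) : Prop :=
  ∃ y : Matrix (Fin k) (Fin k) R, x = star y * y

/-- A ℂ-linear map between C*-algebras is completely positive if, for every `k`, the induced
map on `k × k` matrices maps positive matrices to positive matrices. -/
def IsCP {A : Type u} {B : Type v} [NonUnitalCStarAlgebra A] [NonUnitalCStarAlgebra B]
    (φ : A →ₗ[ℂ] B) : Prop :=
  ∀ (k : ℕ) (x : Matrix (Fin k) (Fin k) A), MatIsPos x → MatIsPos (x.map φ)

/-- The data witnessing one instance of the nuclear dimension condition: a finite-dimensional
C*-algebra `F = F₀ ⊕ ⋯ ⊕ F_n` (modeled as a finite product), a contractive completely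
positive map `ψ : A → F`, and a completely positive map `φ : F → A` whose restriction to each
summand is contractive and order zero, with `φ ∘ ψ` `ε`-approximating the identity on `X`. -/
def NucDimWitness (A : Type u) [NonUnitalCStarAlgebra A] (n : ℕ) (X : Finset A) (ε : ℝ)
    (F : Fin (n + 1) → Type v) [∀ i, NonUnitalCStarAlgebra (F i)] : Prop :=
  (∀ i, FiniteDimensional ℂ (F i)) ∧
  ∃ (ψ : A →ₗ[ℂ] (∀ i, F i)) (φ : (∀ i, F i) →ₗ[ℂ] A),
    IsCP ψ ∧ (∀ a : A, ‖ψ a‖ ≤ ‖a‖) ∧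
    IsCP φ ∧
    (∀ i : Fin (n + 1),
      (∀ x : F i, ‖φ (Pi.single i x)‖ ≤ ‖x‖) ∧
      (∀ x y : F i, (∃ u, x = star u * u) → (∃ v, y = star v * v) → x * y = 0 →
        φ (Pi.single i x) * φ (Pi.single i y) = 0)) ∧
    (∀ x ∈ X, ‖φ (ψ x) - x‖ < ε)

/-- A C*-algebra `A` has nuclear dimension at most `n`. -/
def NuclearDimLE (n : ℕ) (A : Type u) [NonUnitalCStarAlgebra A] : Prop :=
  ∀ (X : Finset A) (ε : ℝ), 0 < ε →
    ∃ (F : Fin (n + 1) → Type) (instF : ∀ i, NonUnitalCStarAlgebra (F i)),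
      @NucDimWitness A _ n X ε F instF
/-- A C*-algebra has real rank zero if every self-adjoint element can be approximated in norm
by self-adjoint elements with finite spectrum. -/
def RealRankZero (A : Type u) [CStarAlgebra A] : Prop :=
  ∀ a : A, IsSelfAdjoint a → ∀ ε : ℝ, 0 < ε →
    ∃ b : A, IsSelfAdjoint b ∧ (spectrum ℝ b).Finite ∧ ‖a - b‖ < ε


section Utils

theorem norm_sq_le_four {A : Type*} [NonUnitalCStarAlgebra A] (x y z w : A) :
    ‖x‖ * ‖x‖ ≤ ‖(star x * x + star y * y) + (star z * z + star w * w)‖ := by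
  letI := CStarAlgebra.spectralOrder A
  haveI := CStarAlgebra.spectralOrderedRing A
  rw [← CStarRing.norm_star_mul_self]
  refine CStarAlgebra.norm_le_norm_of_nonneg_of_le (star_mul_self_nonneg x) ?_
  rw [add_assoc]
  exact le_add_of_nonneg_right (add_nonneg (star_mul_self_nonneg y)
    (add_nonneg (star_mul_self_nonneg z) (star_mul_self_nonneg w)))

theorem norm_sq_le_two {A : Type*} [NonUnitalCStarAlgebra A] (x y : A) :
    ‖x‖ * ‖x‖ ≤ ‖star x * x + star y * y‖ := by
  simpa using norm_sq_le_four x y 0 0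

theorem eq_zero_of_sq_add {A : Type*} [NonUnitalCStarAlgebra A] {x y : A}
    (h : star x * x + star y * y = 0) : x = 0 ∧ y = 0 := by
  constructor
  · have := norm_sq_le_two x y
    rw [h, norm_zero] at this
    exact norm_eq_zero.1 (by nlinarith [norm_nonneg x])
  · have := norm_sq_le_two y x
    rw [add_comm, h, norm_zero] at this
    exact norm_eq_zero.1 (by nlinarith [norm_nonneg y])

theorem norm_one_le_one (A : Type*) [CStarAlgebra A] : ‖(1 : A)‖ ≤ 1 := by
  rcases subsingleton_or_nontrivial A with h | h
  · rw [Subsingleton.elim (1 : A) 0, norm_zero]; exact zero_le_one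
  · exact (CStarRing.norm_one).le

theorem IsCP.decomp {A : Type u} {B : Type v} [NonUnitalCStarAlgebra A]
    [NonUnitalCStarAlgebra B] {φ : A →ₗ[ℂ] B} (hφ : IsCP φ) (x w : A) :
    ∃ a₁ a₂ b₁ b₂ : B,
      φ (x * star x) = star a₁ * a₁ + star a₂ * a₂ ∧
      φ (x * w) = star a₁ * b₁ + star a₂ * b₂ ∧
      φ (star w * star x) = star b₁ * a₁ + star b₂ * a₂ ∧
      φ (star w * w) = star b₁ * b₁ + star b₂ * b₂ := by
  obtain ⟨z, hz⟩ := hφ 2 (star (!![star x, w; 0, 0] : Matrix (Fin 2) (Fin 2) A) *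
    !![star x, w; 0, 0]) ⟨_, rfl⟩
  refine ⟨z 0 0, z 1 0, z 0 1, z 1 1, ?_, ?_, ?_, ?_⟩
  · have := congrFun (congrFun hz 0) 0
    simpa [Matrix.mul_apply, Fin.sum_univ_two, Matrix.star_apply] using this
  · have := congrFun (congrFun hz 0) 1
    simpa [Matrix.mul_apply, Fin.sum_univ_two, Matrix.star_apply] using this
  · have := congrFun (congrFun hz 1) 0
    simpa [Matrix.mul_apply, Fin.sum_univ_two, Matrix.star_apply] using this
  · have := congrFun (congrFun hz 1) 1
    simpa [Matrix.mul_apply, Fin.sum_univ_two, Matrix.star_apply] using this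

theorem IsCP.pos {A : Type u} {B : Type v} [NonUnitalCStarAlgebra A]
    [NonUnitalCStarAlgebra B] {φ : A →ₗ[ℂ] B} (hφ : IsCP φ) (x : A) :
    ∃ y : B, φ (star x * x) = star y * y := by
  obtain ⟨z, hz⟩ := hφ 1 (star (!![x] : Matrix (Fin 1) (Fin 1) A) * !![x]) ⟨_, rfl⟩
  refine ⟨z 0 0, ?_⟩
  have := congrFun (congrFun hz 0) 0
  simpa [Matrix.mul_apply, Matrix.star_apply] using this

theorem IsCP.comp_linear {A B D : Type*} [NonUnitalCStarAlgebra A]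
    [NonUnitalCStarAlgebra B] [NonUnitalCStarAlgebra D] {φ : A →ₗ[ℂ] B} {ψ : B →ₗ[ℂ] D}
    (hψ : IsCP ψ) (hφ : IsCP φ) : IsCP (ψ ∘ₗ φ) := by
  intro k x hx
  have := hψ k _ (hφ k x hx)
  simpa [Matrix.map_map] using this

theorem isCP_of_mul_star {A B : Type*} [NonUnitalCStarAlgebra A]
    [NonUnitalCStarAlgebra B] (φ : A →ₗ[ℂ] B) (hm : ∀ x y, φ (x * y) = φ x * φ y)
    (hs : ∀ x, φ (star x) = star (φ x)) : IsCP φ := by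
  rintro k x ⟨y, rfl⟩
  refine ⟨y.map φ, ?_⟩
  ext i j
  simp [Matrix.mul_apply, Matrix.star_apply, hm, hs]

/-- Approximate Radon-Nikodym: two cp maps whose sum is close to the identity. -/
theorem schwarz_approx {A : Type u} [CStarAlgebra A] {Φ Ψ : A →ₗ[ℂ] A}
    (hΦ : IsCP Φ) (hΨ : IsCP Ψ) (h1 : ‖Φ 1‖ ≤ 1) (a : A) {ε : ℝ}
    (e1 : ‖Φ 1 + Ψ 1 - 1‖ ≤ ε) (e2 : ‖Φ a + Ψ a - a‖ ≤ ε)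
    (e3 : ‖Φ (star a) + Ψ (star a) - star a‖ ≤ ε)
    (e4 : ‖Φ (star a * a) + Ψ (star a * a) - star a * a‖ ≤ ε) :
    ‖Φ 1 * a - Φ a‖ ≤ 2 * (Real.sqrt ε * (1 + ‖a‖)) := by
  obtain ⟨a₁, a₂, b₁, b₂, p1, p2, p3, p4⟩ := hΦ.decomp 1 a
  obtain ⟨c₁, c₂, d₁, d₂, q1, q2, q3, q4⟩ := hΨ.decomp 1 a
  simp only [star_one, mul_one, one_mul] at p1 p2 p3 q1 q2 q3
  have hε : 0 ≤ ε := (norm_nonneg _).trans e1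
  have key : (star (a₁ * a - b₁) * (a₁ * a - b₁) + star (a₂ * a - b₂) * (a₂ * a - b₂)) +
      (star (c₁ * a - d₁) * (c₁ * a - d₁) + star (c₂ * a - d₂) * (c₂ * a - d₂)) =
      star a * (Φ 1 + Ψ 1 - 1) * a - star a * (Φ a + Ψ a - a) -
        (Φ (star a) + Ψ (star a) - star a) * a +
        (Φ (star a * a) + Ψ (star a * a) - star a * a) := by
    rw [p1, p2, p3, p4, q1, q2, q3, q4]
    simp only [star_sub, star_mul]
    noncomm_ring
  have bound : ‖star a * (Φ 1 + Ψ 1 - 1) * a - star a * (Φ a + Ψ a - a) -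
        (Φ (star a) + Ψ (star a) - star a) * a +
        (Φ (star a * a) + Ψ (star a * a) - star a * a)‖ ≤ ε * (1 + ‖a‖) ^ 2 := by
    have n1 : ‖star a * (Φ 1 + Ψ 1 - 1) * a‖ ≤ ‖a‖ * ε * ‖a‖ := by
      refine (norm_mul_le _ _).trans ?_
      gcongr
      refine (norm_mul_le _ _).trans ?_
      rw [norm_star]; gcongr
    have n2 : ‖star a * (Φ a + Ψ a - a)‖ ≤ ‖a‖ * ε := by
      refine (norm_mul_le _ _).trans ?_
      rw [norm_star]; gcongr
    have n3 : ‖(Φ (star a) + Ψ (star a) - star a) * a‖ ≤ ε * ‖a‖ := by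
      refine (norm_mul_le _ _).trans ?_
      gcongr
    refine (norm_add_le _ _).trans ?_
    have := norm_sub_le (star a * (Φ 1 + Ψ 1 - 1) * a - star a * (Φ a + Ψ a - a))
      ((Φ (star a) + Ψ (star a) - star a) * a)
    have := norm_sub_le (star a * (Φ 1 + Ψ 1 - 1) * a) (star a * (Φ a + Ψ a - a))
    nlinarith
  have sq : ∀ t : A, ‖t‖ * ‖t‖ ≤ ε * (1 + ‖a‖) ^ 2 → ‖t‖ ≤ Real.sqrt ε * (1 + ‖a‖) := by
    intro t ht
    refine abs_le_of_sq_le_sq' ?_ (by positivity) |>.2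
    rw [mul_pow, Real.sq_sqrt hε]
    nlinarith
  have t1 : ‖a₁ * a - b₁‖ ≤ Real.sqrt ε * (1 + ‖a‖) := by
    refine sq _ (le_trans ?_ bound)
    rw [← key]; exact norm_sq_le_four _ _ _ _
  have t2 : ‖a₂ * a - b₂‖ ≤ Real.sqrt ε * (1 + ‖a‖) := by
    refine sq _ (le_trans ?_ bound)
    rw [← key, add_comm (star (a₁ * a - b₁) * (a₁ * a - b₁))]; exact norm_sq_le_four _ _ _ _
  have s1 : ‖a₁‖ ≤ 1 := by
    have := norm_sq_le_two a₁ a₂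
    rw [← p1] at this
    nlinarith [norm_nonneg a₁]
  have s2 : ‖a₂‖ ≤ 1 := by
    have := norm_sq_le_two a₂ a₁
    rw [add_comm, ← p1] at this
    nlinarith [norm_nonneg a₂]
  have e : Φ 1 * a - Φ a = star a₁ * (a₁ * a - b₁) + star a₂ * (a₂ * a - b₂) := by
    rw [p1, p2]; noncomm_ring
  rw [e]
  refine (norm_add_le _ _).trans ?_
  have m1 : ‖star a₁ * (a₁ * a - b₁)‖ ≤ 1 * (Real.sqrt ε * (1 + ‖a‖)) := by
    refine (norm_mul_le _ _).trans ?_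
    rw [norm_star]; gcongr
  have m2 : ‖star a₂ * (a₂ * a - b₂)‖ ≤ 1 * (Real.sqrt ε * (1 + ‖a‖)) := by
    refine (norm_mul_le _ _).trans ?_
    rw [norm_star]; gcongr
  linarith

theorem IsCP.map_star_unital {A : Type u} {B : Type v} [CStarAlgebra A]
    [NonUnitalCStarAlgebra B] {φ : A →ₗ[ℂ] B} (hφ : IsCP φ) (a : A) :
    φ (star a) = star (φ a) := by
  obtain ⟨a₁, a₂, b₁, b₂, p1, p2, p3, p4⟩ := hφ.decomp 1 a
  simp only [star_one, mul_one, one_mul] at p1 p2 p3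
  rw [p2, p3]; simp

theorem schwarz_approx_comm {A : Type u} [CStarAlgebra A] {Φ Ψ : A →ₗ[ℂ] A}
    (hΦ : IsCP Φ) (hΨ : IsCP Ψ) (h1 : ‖Φ 1‖ ≤ 1) (a : A) {ε : ℝ}
    (e1 : ‖Φ 1 + Ψ 1 - 1‖ ≤ ε) (e2 : ‖Φ a + Ψ a - a‖ ≤ ε)
    (e3 : ‖Φ (star a) + Ψ (star a) - star a‖ ≤ ε)
    (e4 : ‖Φ (star a * a) + Ψ (star a * a) - star a * a‖ ≤ ε)
    (e5 : ‖Φ (a * star a) + Ψ (a * star a) - a * star a‖ ≤ ε) :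
    ‖Φ 1 * a - a * Φ 1‖ ≤ 4 * (Real.sqrt ε * (1 + ‖a‖)) := by
  have k1 := schwarz_approx hΦ hΨ h1 a e1 e2 e3 e4
  have k2 := schwarz_approx hΦ hΨ h1 (star a) e1 e3 (by simpa using e2) (by simpa using e5)
  have k3 : Φ 1 * star a - Φ (star a) = star (a * Φ 1 - Φ a) := by
    rw [star_sub, star_mul, hΦ.map_star_unital, ← hΦ.map_star_unital 1, star_one]
  rw [k3, norm_star, norm_star] at k2
  have : Φ 1 * a - a * Φ 1 = (Φ 1 * a - Φ a) - (a * Φ 1 - Φ a) := by abel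
  rw [this]
  refine (norm_sub_le _ _).trans ?_
  linarith

end Utils


section FinDim

variable {F : Type*} [NonUnitalCStarAlgebra F]

theorem finite_quasispectrum_of_finiteDimensional [FiniteDimensional ℂ F] (x : F) :
    (quasispectrum ℝ x).Finite := by
  rw [Unitization.quasispectrum_eq_spectrum_inr' ℝ ℂ x]
  have : FiniteDimensional ℂ (Unitization ℂ F) :=
    Module.Finite.of_surjective
      ((Algebra.linearMap ℂ (Unitization ℂ F)).coprod (Unitization.inrHom ℂ ℂ F)) (fun y =>
        ⟨(y.fst, y.snd), by
          ext <;> simp [Algebra.linearMap_apply, Unitization.algebraMap_eq_inl]⟩)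
  have : FiniteDimensional ℝ (Unitization ℂ F) := FiniteDimensional.trans ℝ ℂ _
  have hintegral : IsIntegral ℝ (x : Unitization ℂ F) := Algebra.IsIntegral.isIntegral _
  refine ((minpoly ℝ (x : Unitization ℂ F)).rootSet_finite ℝ).subset ?_
  intro t ht
  have h := spectrum.subset_polynomial_aeval (x : Unitization ℂ F)
    (minpoly ℝ (x : Unitization ℂ F)) ⟨t, ht, rfl⟩
  rw [minpoly.aeval, spectrum.zero_eq] at h
  rw [Polynomial.mem_rootSet]
  exact ⟨minpoly.ne_zero hintegral, by simpa using h⟩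

theorem exists_spectral_proj [FiniteDimensional ℂ F] {x : F} (hx : IsSelfAdjoint x)
    (hx0 : x ≠ 0) : ∃ (r : ℝ) (q : F), r ≠ 0 ∧ q ≠ 0 ∧ star q = q ∧ q * q = q ∧
      x * q = (r : ℂ) • q ∧ ∃ y, q = y * x := by
  have hfin := finite_quasispectrum_of_finiteDimensional x
  obtain ⟨r, hr, hr0⟩ : ∃ r ∈ quasispectrum ℝ x, r ≠ 0 := by
    by_contra! hcon
    exact hx0 (CFC.eq_zero_of_quasispectrum_eq_zero (R := ℝ) x (fun t ht => hcon t ht) hx)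
  have hc : ∀ f : ℝ → ℝ, ContinuousOn f (quasispectrum ℝ x) := fun f => hfin.continuousOn f
  let f : ℝ → ℝ := fun t => if t = r then 1 else 0
  have hf0 : f 0 = 0 := by simp [f, hr0.symm]
  refine ⟨r, cfcₙ f x, hr0, ?_, ?_, ?_, ?_, cfcₙ (fun t => r⁻¹ * f t) x, ?_⟩
  · intro h
    have : cfcₙ f x = cfcₙ (fun _ => 0 : ℝ → ℝ) x := by rw [h, cfcₙ_const_zero]
    have := eqOn_of_cfcₙ_eq_cfcₙ this hx (hc _) hf0 (hc _) rfl hr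
    simp [f] at this
  · exact (cfcₙ_predicate f x : IsSelfAdjoint _)
  · rw [← cfcₙ_mul f f x (hc _) hf0 (hc _) hf0]
    refine cfcₙ_congr fun t _ => ?_
    simp [f]
  · have e : cfcₙ (fun t => r * f t) x = x * cfcₙ f x := by
      have e' := cfcₙ_mul (fun t => t) f x (hc _) rfl (hc _) hf0
      rw [cfcₙ_id' ℝ x hx] at e'
      rw [← e']
      refine cfcₙ_congr fun t _ => ?_
      simp only [f]; split_ifs with h <;> simp [h]
    rw [← e, cfcₙ_const_mul r f x (hc _) hf0]
    exact (Complex.coe_smul r _).symm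
  · have e : cfcₙ (fun t => (r⁻¹ * f t) * t) x = cfcₙ (fun t => r⁻¹ * f t) x * x := by
      rw [cfcₙ_mul (fun t => r⁻¹ * f t) (fun t => t) x (hc _) (by simp [hf0]) (hc _) rfl,
        cfcₙ_id' ℝ x hx]
    rw [← e]
    refine cfcₙ_congr fun t _ => ?_
    simp only [f]; split_ifs with h
    · subst h; field_simp
    · simp

/-- A minimal projection. -/
structure MinProj (e : F) : Prop where
  sa : star e = e
  idem : e * e = e
  ne : e ≠ 0
  min : ∀ x : F, ∃ c : ℂ, e * x * e = c • e

theorem exists_minProj_le [FiniteDimensional ℂ F] {q : F} (hsa : star q = q) (hid : q * q = q)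
    (hq : q ≠ 0) : ∃ e : F, MinProj e ∧ e * q = e := by
  let S : Set F := {r | star r = r ∧ r * r = r ∧ r ≠ 0 ∧ r * q = r}
  let d : F → ℕ := fun r => Module.finrank ℂ (LinearMap.range (LinearMap.mulLeft ℂ r))
  have hS : S.Nonempty := ⟨q, hsa, hid, hq, hid⟩
  obtain ⟨e, ⟨esa, eid, ene, eq⟩, hmin⟩ : ∃ e ∈ S, ∀ r ∈ S, d e ≤ d r := by
    obtain ⟨e, he⟩ := (measure d).wf.has_min S hS
    exact ⟨e, he.1, fun r hr => not_lt.1 (he.2 r hr)⟩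
  -- subprojections of `e` are trivial
  have triv : ∀ r : F, star r = r → r * r = r → r ≠ 0 → r * e = r → r = e := by
    intro r rsa rid rne re
    have er : e * r = r := by
      have := congrArg star re
      rwa [star_mul, rsa, esa] at this
    have hrS : r ∈ S := ⟨rsa, rid, rne, by rw [← re, mul_assoc, eq]⟩
    have hle : LinearMap.range (LinearMap.mulLeft ℂ r) ≤ LinearMap.range (LinearMap.mulLeft ℂ e) := by
      rintro _ ⟨y, rfl⟩
      exact ⟨r * y, by simp [← mul_assoc, er]⟩
    have heq := Submodule.eq_of_le_of_finrank_le hle (hmin r hrS)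
    have : e ∈ LinearMap.range (LinearMap.mulLeft ℂ r) := by
      rw [heq]; exact ⟨e, by simp [eid]⟩
    obtain ⟨y, hy⟩ := this
    simp only [LinearMap.mulLeft_apply] at hy
    rw [← re]
    rw [← hy, ← mul_assoc, rid]
  have sa_case : ∀ x : F, IsSelfAdjoint x → ∃ c : ℂ, e * x * e = c • e := by
    intro x hx
    by_cases h0 : e * x * e = 0
    · exact ⟨0, by simp [h0]⟩
    have hsa' : IsSelfAdjoint (e * x * e) := by
      simp [IsSelfAdjoint, star_mul, esa, hx.star_eq, mul_assoc]
    obtain ⟨r, p, hr, hp, psa, pid, hxp, y, hy⟩ := exists_spectral_proj hsa' h0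
    have hpe : p * e = p := by
      rw [hy]; simp [mul_assoc, eid]
    have := triv p psa pid hp hpe
    subst this
    refine ⟨r, ?_⟩
    rw [← hxp]; simp [mul_assoc, eid]
  refine ⟨e, ⟨esa, eid, ene, fun x => ?_⟩, eq⟩
  obtain ⟨c, hc⟩ := sa_case (realPart x : F) (realPart x).2
  obtain ⟨c', hc'⟩ := sa_case (imaginaryPart x : F) (imaginaryPart x).2
  refine ⟨c + Complex.I * c', ?_⟩
  conv_lhs => rw [← realPart_add_I_smul_imaginaryPart x]
  rw [mul_add, add_mul, hc, mul_smul_comm, smul_mul_assoc, hc', add_smul, mul_smul]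

theorem MinProj.normalize {e : F} (he : MinProj e) {y : F} (hye : y * e = y) (hy : y ≠ 0) :
    ∃ c : ℝ, star ((c : ℂ) • y) * ((c : ℂ) • y) = e := by
  let := CStarAlgebra.spectralOrder F
  have := CStarAlgebra.spectralOrderedRing F
  obtain ⟨l, hl⟩ := he.min (star y * y)
  have h1 : e * (star y * y) * e = star y * y := by
    have : e * star y = star y := by
      have := congrArg star hye
      rwa [star_mul, he.sa] at this
    rw [← mul_assoc, this, mul_assoc, hye]
  rw [h1] at hl
  have hreal : (starRingEnd ℂ) l = l := by
    have := congrArg star hl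
    rw [star_mul, star_star, star_smul, he.sa, hl] at this
    have h2 : (l - (starRingEnd ℂ) l) • e = 0 := by
      rw [sub_smul, this]; simp
    rcases smul_eq_zero.1 h2 with h | h
    · exact (sub_eq_zero.1 h).symm
    · exact absurd h he.ne
  obtain ⟨r, rfl⟩ := Complex.conj_eq_iff_real.1 hreal
  have hyy : star y * y ≠ 0 := fun h => hy ((CStarRing.star_mul_self_eq_zero_iff y).1 h)
  have hr : 0 < r := by
    by_contra! hr
    apply hyy
    refine le_antisymm ?_ (star_mul_self_nonneg y)
    have e0 : 0 ≤ star (((Real.sqrt (-r) : ℝ) : ℂ) • e) * (((Real.sqrt (-r) : ℝ) : ℂ) • e) :=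
      star_mul_self_nonneg _
    rw [star_smul, smul_mul_smul_comm, he.sa, he.idem] at e0
    have : star ((Real.sqrt (-r) : ℝ) : ℂ) * ((Real.sqrt (-r) : ℝ) : ℂ) = -(r : ℂ) := by
      rw [Complex.star_def, Complex.conj_ofReal, ← Complex.ofReal_mul,
        Real.mul_self_sqrt (by linarith)]
      simp
    rw [this, neg_smul, ← hl] at e0
    simpa using e0
  refine ⟨(Real.sqrt r)⁻¹, ?_⟩
  rw [star_smul, smul_mul_smul_comm, hl, smul_smul]
  have : star (((Real.sqrt r)⁻¹ : ℝ) : ℂ) * (((Real.sqrt r)⁻¹ : ℝ) : ℂ) * (r : ℂ) = 1 := by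
    rw [Complex.star_def, Complex.conj_ofReal, ← Complex.ofReal_mul, ← Complex.ofReal_mul,
      ← mul_inv, Real.mul_self_sqrt hr.le, inv_mul_cancel₀ hr.ne']
    simp
  rw [this, one_smul]

/-- A family of partial isometries with minimal source projections. -/
structure IsFam {n : ℕ} (v e : Fin n → F) : Prop where
  min : ∀ i, MinProj (e i)
  orth : ∀ i l, star (v i) * v l = if i = l then e i else 0
  dich : ∀ i l, e i = e l ∨ ∀ x, e i * x * e l = 0

theorem IsFam.mul_e {n : ℕ} {v e : Fin n → F} (h : IsFam v e) (i : Fin n) : v i * e i = v i := by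
  have hm := h.min i
  have h1 : star (v i) * v i = e i := by simpa using h.orth i i
  rw [← sub_eq_zero, ← CStarRing.star_mul_self_eq_zero_iff]
  simp only [star_sub, star_mul, hm.sa, sub_mul, mul_sub]
  simp [mul_assoc, h1, hm.idem, ← mul_assoc (star (v i)) (v i)]

theorem IsFam.extend {n : ℕ} {v e : Fin n → F} (h : IsFam v e) {y e0 : F} (he0 : MinProj e0)
    (hy : star y * y = e0) (hvy : ∀ i, star (v i) * y = 0)
    (hd : ∀ i, e i = e0 ∨ ∀ x, e i * x * e0 = 0) :
    IsFam (Fin.cons y v : Fin (n + 1) → F) (Fin.cons e0 e : Fin (n + 1) → F) := by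
  refine ⟨fun i => ?_, fun i l => ?_, fun i l => ?_⟩
  · refine Fin.cases ?_ (fun i => ?_) i
    · simpa using he0
    · simpa using h.min i
  · refine Fin.cases ?_ (fun i => ?_) i <;> refine Fin.cases ?_ (fun l => ?_) l
    · simpa using hy
    · have := congrArg star (hvy l)
      simpa [(Fin.succ_ne_zero l).symm] using this
    · simpa using hvy i
    · simpa using h.orth i l
  · refine Fin.cases ?_ (fun i => ?_) i <;> refine Fin.cases ?_ (fun l => ?_) l
    · left; rfl
    · rcases hd l with h' | h'
      · left; simpa using h'.symm
      · right
        intro x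
        have := congrArg star (h' (star x))
        simpa [star_mul, he0.sa, (h.min l).sa, mul_assoc] using this
    · simpa using hd i
    · simpa using h.dich i l

theorem IsFam.card_le [FiniteDimensional ℂ F] {n : ℕ} {v e : Fin n → F} (h : IsFam v e) :
    n ≤ Module.finrank ℂ F := by
  have : LinearIndependent ℂ v := by
    rw [Fintype.linearIndependent_iff]
    intro g hg l
    have := congrArg (fun z => star (v l) * z) hg
    simp only [Finset.mul_sum, mul_smul_comm, h.orth, mul_zero] at this
    simp only [smul_ite, smul_zero, Finset.sum_ite_eq, Finset.mem_univ, if_true] at this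
    rcases smul_eq_zero.1 this with h' | h'
    · exact h'
    · exact absurd h' (h.min l).ne
  simpa using this.fintype_card_le_finrank

theorem exists_max_fam (F : Type*) [NonUnitalCStarAlgebra F] [FiniteDimensional ℂ F] :
    ∃ (n : ℕ) (v e : Fin n → F), IsFam v e ∧ ∀ x, x = (∑ i, v i * star (v i)) * x := by
  classical
  let P : ℕ → Prop := fun n => ∃ v e : Fin n → F, IsFam v e
  have P0 : P 0 := ⟨Fin.elim0, Fin.elim0, ⟨fun i => i.elim0, fun i => i.elim0, fun i => i.elim0⟩⟩
  let n := Nat.findGreatest P (Module.finrank ℂ F)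
  obtain ⟨v, e, hve⟩ : P n := Nat.findGreatest_spec (P := P) (Nat.zero_le _) P0
  have hmax : ¬ P (n + 1) := by
    intro hP
    have hle : n + 1 ≤ Module.finrank ℂ F := by
      obtain ⟨v', e', h'⟩ := hP
      exact h'.card_le
    exact absurd (Nat.le_findGreatest hle hP) (by simp [n])
  refine ⟨n, v, e, hve, fun x => ?_⟩
  by_contra hx
  set z := ∑ i, v i * star (v i) with hz
  have hvz : ∀ l, star (v l) * z = star (v l) := by
    intro l
    have : e l * star (v l) = star (v l) := by
      have := congrArg star (hve.mul_e l)
      rwa [star_mul, (hve.min l).sa] at this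
    simp [hz, Finset.mul_sum, ← mul_assoc, hve.orth, this]
  set x' := x - z * x with hx'
  have hxz0 : x' ≠ 0 := sub_ne_zero.2 hx
  have hvx : ∀ l, star (v l) * x' = 0 := by
    intro l; rw [hx', mul_sub, ← mul_assoc, hvz, sub_self]
  by_cases hcase : ∃ i f, x' * f * e i ≠ 0
  · obtain ⟨i, f, hf⟩ := hcase
    obtain ⟨c, hc⟩ := (hve.min i).normalize (y := x' * f * e i)
      (by rw [mul_assoc, (hve.min i).idem]) hf
    refine hmax ⟨_, _, hve.extend (hve.min i) hc (fun l => ?_) (fun l => hve.dich l i)⟩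
    rw [mul_smul_comm, ← mul_assoc, ← mul_assoc, hvx]; simp
  · push Not at hcase
    have hne : star x' * x' ≠ 0 := fun h => hxz0 ((CStarRing.star_mul_self_eq_zero_iff x').1 h)
    obtain ⟨r, q, hr, hq, qsa, qid, -, y, hy⟩ :=
      exists_spectral_proj (IsSelfAdjoint.star_mul_self x') hne
    obtain ⟨e0, he0, he0q⟩ := exists_minProj_le qsa qid hq
    have hz0 : ∀ i f, e0 * f * e i = 0 := by
      intro i f
      rw [← he0q, hy]
      simp only [mul_assoc]
      have := hcase i f
      rw [mul_assoc] at this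
      rw [this]; simp
    have hz1 : ∀ i f, e i * f * e0 = 0 := by
      intro i f
      have := congrArg star (hz0 i (star f))
      simpa [star_mul, he0.sa, (hve.min i).sa, mul_assoc] using this
    refine hmax ⟨_, _, hve.extend he0 (y := e0) (by rw [he0.sa, he0.idem]) (fun l => ?_)
      (fun l => Or.inr (hz1 l))⟩
    have := hz0 l (v l)
    rw [mul_assoc, hve.mul_e] at this
    have := congrArg star this
    simpa [he0.sa] using this

/-- Matrix units for a finite-dimensional C*-algebra. -/
theorem exists_matrix_units (F : Type*) [NonUnitalCStarAlgebra F] [FiniteDimensional ℂ F] :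
    ∃ (n : ℕ) (c : Fin n → Fin n) (V : Fin n → F),
      (∀ i, c (c i) = c i) ∧ (∀ i, star (V (c i)) = V (c i)) ∧
      (∀ i, V i * V (c i) = V i) ∧
      (∀ i l, star (V i) * V l = if i = l then V (c i) else 0) ∧
      (∀ i l, c i ≠ c l → V i * star (V l) = 0) ∧
      (∀ x, (∑ i, V i * star (V i)) * x = x) ∧
      (∀ x, ∃ k : Fin n → Fin n → ℂ, (∀ i l, c i ≠ c l → k i l = 0) ∧
        x = ∑ i, ∑ l, k i l • (V i * star (V l))) := by
  obtain ⟨n, v, e, hve, hu⟩ := exists_max_fam F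
  let c : Fin n → Fin n := fun i => Set.rangeSplitting e ⟨e i, i, rfl⟩
  have hc : ∀ i, e (c i) = e i := fun i => Set.apply_rangeSplitting e _
  have hcc : ∀ i l, e i = e l → c i = c l := by
    intro i l h
    simp only [c, h]
  have hcc' : ∀ i l, c i = c l → e i = e l := fun i l h => by rw [← hc i, h, hc l]
  have star_e : ∀ i, e i * star (v i) = star (v i) := by
    intro i
    have := congrArg star (hve.mul_e i)
    rwa [star_mul, (hve.min i).sa] at this
  have hvv : ∀ i, star (v i) * v i = e i := fun i => by simpa using hve.orth i i
  -- products
  have hVV : ∀ i l, c i = c l → (v i * star (v (c i))) * star (v l * star (v (c l))) =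
      v i * star (v l) := by
    intro i l h
    rw [star_mul, star_star, mul_assoc, ← mul_assoc (star (v (c i))), ← h, hvv, hc, ← mul_assoc,
      hve.mul_e]
  refine ⟨n, c, fun i => v i * star (v (c i)), fun i => hcc _ _ (hc i), fun i => ?_, fun i => ?_,
    fun i l => ?_, fun i l h => ?_, fun x => ?_, fun x => ?_⟩
  · simp [hcc _ _ (hc i)]
  · have := hcc _ _ (hc i)
    simp only [this]
    rw [mul_assoc, ← mul_assoc (star (v (c i))), hvv, star_e]
  · simp only [star_mul, star_star]
    rw [mul_assoc, ← mul_assoc (star (v i)), hve.orth]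
    split_ifs with h
    · subst h
      rw [← mul_assoc, ← hc i, hve.mul_e, hcc _ _ (hc i)]
    · simp
  · simp only [star_mul, star_star]
    rw [mul_assoc, ← mul_assoc (star (v (c i))), hve.orth]
    rw [if_neg h]; simp
  · conv_rhs => rw [hu x]
    congr 1
    exact Finset.sum_congr rfl fun i _ => hVV i i rfl
  · have hz : star (∑ i, v i * star (v i)) = ∑ i, v i * star (v i) := by
      simp [star_sum]
    have hu' : ∀ x, x = x * (∑ i, v i * star (v i)) := by
      intro x
      have := congrArg star (hu (star x))
      rwa [star_mul, star_star, hz] at this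
    have hk : ∀ i l, ∃ k : ℂ, (c i ≠ c l → k = 0) ∧
        v i * star (v i) * x * (v l * star (v l)) =
          k • ((v i * star (v (c i))) * star (v l * star (v (c l)))) := by
      intro i l
      have h1 : v i * star (v i) * x * (v l * star (v l)) =
          v i * (e i * (star (v i) * x * v l) * e l) * star (v l) := by
        conv_lhs => rw [← star_e i, ← star_e l]
        simp only [mul_assoc]
      by_cases h : c i = c l
      · have hel := hcc' i l h
        obtain ⟨k, hk⟩ := (hve.min i).min (star (v i) * x * v l)
        refine ⟨k, fun h' => absurd h h', ?_⟩
        rw [h1, ← hel, hk, hVV i l h, mul_smul_comm, hve.mul_e, smul_mul_assoc]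
      · refine ⟨0, fun _ => rfl, ?_⟩
        rcases hve.dich i l with h' | h'
        · exact absurd (hcc _ _ h') h
        · rw [h1, h']; simp
    choose k hk0 hk using hk
    refine ⟨k, hk0, ?_⟩
    conv_lhs => rw [hu' x, hu x]
    simp only [Finset.sum_mul, Finset.mul_sum]
    rw [Finset.sum_comm]
    exact Finset.sum_congr rfl fun i _ => Finset.sum_congr rfl fun l _ => hk i l

end FinDim


section RR0

theorem abs_le_norm_of_mem_spectrum {A : Type*} [CStarAlgebra A] {a : A} {t : ℝ}
    (ht : t ∈ spectrum ℝ a) : |t| ≤ ‖a‖ := by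
  have h := spectrum.norm_le_norm_mul_of_mem ht
  rw [Real.norm_eq_abs] at h
  nlinarith [norm_one_le_one A, norm_nonneg a]

open scoped Pointwise in
theorem abs_one_sub_le_of_mem_spectrum {A : Type*} [CStarAlgebra A] {a : A} {t : ℝ}
    (ht : t ∈ spectrum ℝ a) : |1 - t| ≤ ‖1 - a‖ := by
  refine abs_le_norm_of_mem_spectrum ?_
  have h := spectrum.sub_singleton_eq a (1 : ℝ)
  have h2 : t - 1 ∈ spectrum ℝ (a - 1) := by
    have : t - 1 ∈ spectrum ℝ a - {(1 : ℝ)} := Set.sub_mem_sub ht (Set.mem_singleton _)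
    rw [h] at this
    simpa using this
  have h3 := spectrum.neg_eq (R := ℝ) (a - 1)
  rw [neg_sub] at h3
  rw [← h3, Set.mem_neg]
  simpa using h2

theorem norm_one_sub_le_one {A : Type*} [CStarAlgebra A] {a : A} (ha : ∃ y, a = star y * y)
    (h1 : ‖a‖ ≤ 1) : ‖1 - a‖ ≤ 1 := by
  let := CStarAlgebra.spectralOrder A
  have := CStarAlgebra.spectralOrderedRing A
  obtain ⟨y, rfl⟩ := ha
  have h0 : 0 ≤ star y * y := star_mul_self_nonneg y
  have h2 : star y * y ≤ 1 := (CStarAlgebra.norm_le_one_iff_of_nonneg _ h0).1 h1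
  exact (CStarAlgebra.norm_le_one_iff_of_nonneg _ (sub_nonneg.2 h2)).2 (sub_le_self _ h0)

theorem spectrum_mem_unit {A : Type*} [CStarAlgebra A] {a : A} (ha : ∃ y, a = star y * y)
    (h1 : ‖a‖ ≤ 1) {t : ℝ} (ht : t ∈ spectrum ℝ a) : 0 ≤ t ∧ t ≤ 1 := by
  have k1 := (abs_one_sub_le_of_mem_spectrum ht).trans (norm_one_sub_le_one ha h1)
  have k2 := (abs_le_norm_of_mem_spectrum ht).trans h1
  rw [abs_le] at k1 k2
  constructor <;> linarith

theorem norm_mul_one_sub_pow_le {A : Type*} [CStarAlgebra A] {a : A} (ha : ∃ y, a = star y * y)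
    (h1 : ‖a‖ ≤ 1) (N : ℕ) (hN : 0 < N) : ‖(1 - a) ^ N * a‖ ≤ 1 / N := by
  have hsa : IsSelfAdjoint a := by obtain ⟨y, rfl⟩ := ha; exact IsSelfAdjoint.star_mul_self y
  have e : cfc (fun t : ℝ => (1 - t) ^ N * t) a = (1 - a) ^ N * a := by
    rw [cfc_mul (fun t : ℝ => (1 - t) ^ N) (fun t => t) a, cfc_pow (fun t : ℝ => 1 - t) N a,
      cfc_sub (fun _ : ℝ => (1 : ℝ)) (fun t => t) a, cfc_const_one ℝ a, cfc_id' ℝ a]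
  rw [← e]
  refine norm_cfc_le (by positivity) fun t ht => ?_
  obtain ⟨t0, t1⟩ := spectrum_mem_unit ha h1 ht
  have hN' : (0 : ℝ) < N := by exact_mod_cast hN
  have p1 : 0 ≤ (1 - t) ^ N := pow_nonneg (by linarith) _
  rw [Real.norm_eq_abs, abs_of_nonneg (mul_nonneg p1 t0), le_div_iff₀ hN']
  have b1 : 1 + (N : ℝ) * t ≤ (1 + t) ^ N := one_add_mul_le_pow (by linarith) N
  have b2 : (1 - t) ^ N * (1 + t) ^ N ≤ 1 := by
    rw [← mul_pow]
    exact pow_le_one₀ (by nlinarith) (by nlinarith)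
  nlinarith

theorem finiteDimensional_cfcHom_range {A : Type*} [CStarAlgebra A] (b : A) [IsStarNormal b]
    (hfin : (spectrum ℂ b).Finite) :
    FiniteDimensional ℂ (LinearMap.range
      ((cfcHom (R := ℂ) (a := b) ‹_› : C(spectrum ℂ b, ℂ) →⋆ₐ[ℂ] A).toAlgHom.toLinearMap)) := by
  have : Finite (spectrum ℂ b) := hfin
  have : FiniteDimensional ℂ C(spectrum ℂ b, ℂ) :=
    FiniteDimensional.of_injective
      (⟨⟨fun f => (f : spectrum ℂ b → ℂ), fun _ _ => rfl⟩, fun _ _ => rfl⟩ :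
        C(spectrum ℂ b, ℂ) →ₗ[ℂ] (spectrum ℂ b → ℂ)) DFunLike.coe_injective
  infer_instance

/-- cut-down algebra generated by an element with finite spectrum -/
theorem exists_cut_algebra {A : Type*} [CStarAlgebra A] {b : A} (hb : IsSelfAdjoint b)
    (hfin : (spectrum ℝ b).Finite) (f : ℝ → ℝ) (hf : ∀ t, f t * f t = f t) :
    ∃ B : NonUnitalStarSubalgebra ℂ A, FiniteDimensional ℂ B ∧
      b * cfc f b ∈ B ∧ ∀ x ∈ B, cfc f b * x = x := by
  have hn : IsStarNormal b := hb.isStarNormal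
  have hfinC : (spectrum ℂ b).Finite := by
    rw [← hb.spectrumRestricts.algebraMap_image]
    exact hfin.image _
  let H : C(spectrum ℂ b, ℂ) →⋆ₐ[ℂ] A := cfcHom (R := ℂ) (a := b) hn
  have hcf : cfc f b ∈ Set.range H := by
    rw [cfc_real_eq_complex f hb, cfc_apply (R := ℂ) _ b hn (hfinC.continuousOn _)]
    exact ⟨_, rfl⟩
  have hbm : b ∈ Set.range H := ⟨_, cfcHom_id (R := ℂ) hn⟩
  have hcomm : ∀ x ∈ Set.range H, ∀ y ∈ Set.range H, x * y = y * x := by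
    rintro _ ⟨x, rfl⟩ _ ⟨y, rfl⟩
    rw [← map_mul, mul_comm, map_mul]
  have hpsa : star (cfc f b) = cfc f b := (cfc_predicate f b : IsSelfAdjoint _)
  have hpp : cfc f b * cfc f b = cfc f b := by
    rw [← cfc_mul f f b (hfin.continuousOn _) (hfin.continuousOn _)]
    exact cfc_congr fun t _ => hf t
  let B : NonUnitalStarSubalgebra ℂ A :=
    { carrier := {x | x ∈ Set.range H ∧ cfc f b * x = x}
      zero_mem' := ⟨⟨0, map_zero H⟩, mul_zero _⟩
      add_mem' := by
        rintro _ _ ⟨⟨x, rfl⟩, hx⟩ ⟨⟨y, rfl⟩, hy⟩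
        exact ⟨⟨x + y, map_add H x y⟩, by rw [mul_add, hx, hy]⟩
      mul_mem' := by
        rintro _ _ ⟨⟨x, rfl⟩, hx⟩ ⟨⟨y, rfl⟩, hy⟩
        exact ⟨⟨x * y, map_mul H x y⟩, by rw [← mul_assoc, hx]⟩
      smul_mem' := by
        rintro c _ ⟨⟨x, rfl⟩, hx⟩
        exact ⟨⟨c • x, map_smul H c x⟩, by rw [mul_smul_comm, hx]⟩
      star_mem' := by
        rintro _ ⟨⟨x, rfl⟩, hx⟩
        refine ⟨⟨star x, map_star H x⟩, ?_⟩
        have := congrArg star hx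
        rw [star_mul, hpsa] at this
        rw [hcomm _ hcf _ ⟨star x, map_star H x⟩, this] }
  refine ⟨B, ?_, ⟨?_, ?_⟩, fun x hx => hx.2⟩
  · have hfd := finiteDimensional_cfcHom_range b hfinC
    have hle : B.toNonUnitalSubalgebra.toSubmodule ≤ LinearMap.range H.toAlgHom.toLinearMap := by
      rintro _ ⟨⟨x, rfl⟩, -⟩
      exact ⟨x, rfl⟩
    exact Submodule.finiteDimensional_of_le hle
  · obtain ⟨x, hx⟩ := hbm
    obtain ⟨y, hy⟩ := hcf
    exact ⟨x * y, by rw [map_mul, hx, hy]⟩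
  · rw [← mul_assoc, hcomm _ hcf _ hbm, mul_assoc, hpp]

theorem exists_inv_sqrt {A : Type*} [CStarAlgebra A] {y : A} (hy : IsSelfAdjoint y) {k : ℝ}
    (hk : k ≤ 1 / 2) (hyk : ‖1 - y‖ ≤ k) :
    ∃ s : A, star s = s ∧ s * y * s = 1 ∧ ‖s - 1‖ ≤ 2 * k ∧ ∀ p, Commute y p → Commute s p := by
  have hk0 : 0 ≤ k := (norm_nonneg _).trans hyk
  have hspec : ∀ t ∈ spectrum ℝ y, |1 - t| ≤ k := fun t ht =>
    (abs_one_sub_le_of_mem_spectrum ht).trans hyk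
  have hpos : ∀ t ∈ spectrum ℝ y, 1 / 2 ≤ t := fun t ht => by
    have := abs_le.1 (hspec t ht); linarith
  have hc : ContinuousOn (fun t : ℝ => (Real.sqrt t)⁻¹) (spectrum ℝ y) := by
    refine ContinuousOn.inv₀ Real.continuous_sqrt.continuousOn fun t ht => ?_
    have := hpos t ht
    exact (Real.sqrt_pos.2 (by linarith)).ne'
  refine ⟨cfc (fun t : ℝ => (Real.sqrt t)⁻¹) y, (cfc_predicate _ y : IsSelfAdjoint _), ?_, ?_, ?_⟩
  · have e := cfc_mul (fun t : ℝ => (Real.sqrt t)⁻¹ * t) (fun t : ℝ => (Real.sqrt t)⁻¹) y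
      (hc.mul continuousOn_id) hc
    rw [cfc_mul (fun t : ℝ => (Real.sqrt t)⁻¹) (fun t => t) y hc continuousOn_id,
      cfc_id' ℝ y] at e
    rw [← e, ← cfc_const_one ℝ y]
    refine cfc_congr fun t ht => ?_
    have h0 := hpos t ht
    have h1 : 0 < Real.sqrt t := Real.sqrt_pos.2 (by linarith)
    have h2 : Real.sqrt t * Real.sqrt t = t := Real.mul_self_sqrt (by linarith)
    field_simp
    nlinarith
  · have e := cfc_sub (fun t : ℝ => (Real.sqrt t)⁻¹) (fun _ => (1 : ℝ)) y hc continuousOn_const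
    rw [cfc_const_one ℝ y] at e
    rw [← e]
    refine norm_cfc_le (by linarith) fun t ht => ?_
    have h0 := hpos t ht
    have h1 : 0 < Real.sqrt t := Real.sqrt_pos.2 (by linarith)
    have h2 : Real.sqrt t * Real.sqrt t = t := Real.mul_self_sqrt (by linarith)
    have h3 : 1 / 2 ≤ Real.sqrt t := by nlinarith
    have e2 : (Real.sqrt t)⁻¹ - 1 = (1 - t) / (Real.sqrt t * (1 + Real.sqrt t)) := by
      field_simp; nlinarith
    rw [Real.norm_eq_abs, e2, abs_div, abs_of_pos (show 0 < Real.sqrt t * (1 + Real.sqrt t) by positivity),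
      div_le_iff₀ (by positivity)]
    have := hspec t ht
    nlinarith
  · intro p hp
    exact hp.cfc_real _

theorem rr0_data {A : Type u} [CStarAlgebra A] (hrr : RealRankZero A) {η : ℝ} (hη : 0 < η)
    (hη1 : η ≤ 1) : ∃ N0 : ℕ, ∀ N ≥ N0, ∀ a : A, (∃ y, a = star y * y) → ‖a‖ ≤ 1 →
      ∃ (p s b : A) (B : NonUnitalStarSubalgebra ℂ A), FiniteDimensional ℂ B ∧
        star p = p ∧ p * s = s ∧ star s = s ∧ b ∈ B ∧ (∀ x ∈ B, p * x = x) ∧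
        s * ((1 - (1 - a) ^ N) * (1 - (1 - a) ^ N)) * s = p ∧ ‖s * b * s - a‖ ≤ η := by
  obtain ⟨N0, hN0⟩ := exists_pow_lt_of_lt_one (show 0 < η / 128 by positivity)
    (show 1 - η / 8 < 1 by linarith)
  refine ⟨N0, fun N hN a ha ha1 => ?_⟩
  have hNκ : (1 - η / 8) ^ N ≤ η / 128 :=
    (pow_le_pow_of_le_one (by linarith) (by linarith) hN).trans hN0.le
  have hasa : IsSelfAdjoint a := by obtain ⟨y, rfl⟩ := ha; exact IsSelfAdjoint.star_mul_self y
  have h1a := norm_one_sub_le_one ha ha1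
  have hcont : Continuous (fun x : A => (1 - x) ^ N) := by fun_prop
  obtain ⟨τ0, hτ0, hτ⟩ := Metric.continuous_iff.1 hcont a (η / 128) (by positivity)
  obtain ⟨b0, hb0, hfin, hb0a⟩ := hrr a hasa (min τ0 (η / 8)) (by positivity)
  have hd1 : ‖a - b0‖ < τ0 := hb0a.trans_le (min_le_left _ _)
  have hd2 : ‖a - b0‖ < η / 8 := hb0a.trans_le (min_le_right _ _)
  have hpow : ‖(1 - a) ^ N - (1 - b0) ^ N‖ < η / 128 := by
    have := hτ b0 (by rwa [dist_comm, dist_eq_norm])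
    rwa [dist_comm, dist_eq_norm] at this
  have hc : ∀ f : ℝ → ℝ, ContinuousOn f (spectrum ℝ b0) := fun f => hfin.continuousOn f
  have hs1 : ∀ t ∈ spectrum ℝ b0, |1 - t| ≤ 1 + η / 8 := fun t ht => by
    refine (abs_one_sub_le_of_mem_spectrum ht).trans ?_
    have : 1 - b0 = (1 - a) + (a - b0) := by abel
    rw [this]
    exact (norm_add_le _ _).trans (by linarith)
  have hs2 : ∀ t ∈ spectrum ℝ b0, |t| ≤ 1 + η / 8 := fun t ht => by
    refine (abs_le_norm_of_mem_spectrum ht).trans ?_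
    have : b0 = a - (a - b0) := by abel
    rw [this]
    exact (norm_sub_le _ _).trans (by linarith)
  let f : ℝ → ℝ := fun t => if η / 8 ≤ t then 1 else 0
  have hff : ∀ t, f t * f t = f t := fun t => by simp [f]
  obtain ⟨B, hB, hbB, hpB⟩ := exists_cut_algebra hb0 hfin f hff
  set p := cfc f b0 with hp
  have hpsa : star p = p := (cfc_predicate f b0 : IsSelfAdjoint _)
  have hpp : p * p = p := by
    rw [hp, ← cfc_mul f f b0 (hc _) (hc _)]
    exact cfc_congr fun t _ => hff t
  have hpn : ‖p‖ ≤ 1 := norm_cfc_le zero_le_one fun t _ => by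
    simp only [f]; split_ifs <;> simp
  have hb0p : ‖b0 - b0 * p‖ ≤ η / 8 := by
    have e : cfc (fun t : ℝ => t - t * f t) b0 = b0 - b0 * p := by
      rw [cfc_sub (fun t : ℝ => t) (fun t => t * f t) b0 (hc _) (hc _),
        cfc_mul (fun t : ℝ => t) f b0 (hc _) (hc _), cfc_id' ℝ b0]
    rw [← e]
    refine norm_cfc_le (by positivity) fun t ht => ?_
    have k1 := abs_le.1 (hs1 t ht)
    simp only [f]
    split_ifs with h
    · simp; positivity
    · rw [Real.norm_eq_abs, abs_le]
      constructor <;> linarith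
  have hbp : ‖(1 - b0) ^ N * p‖ ≤ η / 128 := by
    have e : cfc (fun t : ℝ => (1 - t) ^ N * f t) b0 = (1 - b0) ^ N * p := by
      rw [cfc_mul (fun t : ℝ => (1 - t) ^ N) f b0 (hc _) (hc _), cfc_pow (fun t : ℝ => 1 - t) N b0,
        cfc_sub (fun _ : ℝ => (1 : ℝ)) (fun t => t) b0, cfc_const_one ℝ b0, cfc_id' ℝ b0]
    rw [← e]
    refine norm_cfc_le (by positivity) fun t ht => ?_
    have k2 := abs_le.1 (hs2 t ht)
    simp only [f]
    split_ifs with h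
    · rw [mul_one, norm_pow, Real.norm_eq_abs]
      refine le_trans (pow_le_pow_left₀ (abs_nonneg _) ?_ N) hNκ
      rw [abs_le]; constructor <;> linarith
    · simp; positivity
  set w := (1 - a) ^ N with hw
  have hwp : ‖w * p‖ ≤ η / 64 := by
    have : w * p = (w - (1 - b0) ^ N) * p + (1 - b0) ^ N * p := by noncomm_ring
    rw [this]
    refine (norm_add_le _ _).trans ?_
    have := norm_mul_le (w - (1 - b0) ^ N) p
    nlinarith [norm_nonneg (w - (1 - b0) ^ N), norm_nonneg p]
  have hwn : ‖w‖ ≤ 1 := by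
    rcases Nat.eq_zero_or_pos N with h | h
    · rw [hw, h, pow_zero]; exact norm_one_le_one A
    · exact (norm_pow_le' _ h).trans (pow_le_one₀ (norm_nonneg _) h1a)
  have hwsa : star w = w := by
    rw [hw, star_pow, star_sub, star_one, hasa.star_eq]
  set g := 1 - w with hg
  set y := p * (g * g) * p + (1 - p) with hy
  have hysa : IsSelfAdjoint y := by
    simp only [IsSelfAdjoint, hy, hg, star_add, star_mul, star_sub, star_one, hpsa, hwsa, mul_assoc]
  have hy1 : ‖1 - y‖ ≤ η / 16 := by
    have e : 1 - y = p * (2 - w) * (w * p) := by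
      have e1 : p * (2 - w) * (w * p) = p * (1 - g * g) * p := by
        rw [hg]; noncomm_ring
      have e2 : p * (1 - g * g) * p = p * p - p * (g * g) * p := by noncomm_ring
      rw [e1, e2, hpp, hy]; abel
    rw [e]
    have n1 : ‖(2 : A) - w‖ ≤ 3 := by
      have : (2 : A) - w = 1 + (1 - w) := by rw [← one_add_one_eq_two]; abel
      rw [this]
      refine (norm_add_le _ _).trans ?_
      have := norm_sub_le (1 : A) w
      have := norm_one_le_one A
      linarith
    have n2 := norm_mul_le p (2 - w)
    have n3 : ‖p * (2 - w)‖ ≤ 3 := by nlinarith [norm_nonneg p, norm_nonneg ((2 : A) - w)]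
    have n4 := norm_mul_le (p * (2 - w)) (w * p)
    nlinarith [norm_nonneg (p * (2 - w)), norm_nonneg (w * p)]
  have hyp : y * p = p * (g * g) * p := by
    have k : (1 - p) * p = 0 := by rw [sub_mul, one_mul, hpp, sub_self]
    rw [hy, add_mul, k, mul_assoc, hpp, add_zero]
  have hpy : p * y = p * (g * g) * p := by
    have k : p * (1 - p) = 0 := by rw [mul_sub, mul_one, hpp, sub_self]
    rw [hy, mul_add, k, ← mul_assoc, ← mul_assoc, hpp, add_zero]
  obtain ⟨s, hssa, hsys, hs1', hscomm⟩ := exists_inv_sqrt hysa (k := η / 16) (by linarith) hy1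
  have hsp : s * p = p * s := hscomm p (hyp.trans hpy.symm)
  have hpb : p * (b0 * p) = b0 * p := hpB _ hbB
  have hb0b : ‖a - b0 * p‖ ≤ η / 4 := by
    have : a - b0 * p = (a - b0) + (b0 - b0 * p) := by abel
    rw [this]
    exact (norm_add_le _ _).trans (by linarith)
  have hbn : ‖b0 * p‖ ≤ 3 / 2 := by
    have : b0 * p = a - (a - b0 * p) := by abel
    rw [this]
    exact (norm_sub_le _ _).trans (by linarith)
  refine ⟨p, s * p, b0 * p, B, hB, hpsa, ?_, ?_, hbB, hpB, ?_, ?_⟩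
  · rw [hsp, ← mul_assoc, hpp]
  · rw [star_mul, hssa, hpsa, hsp]
  · calc s * p * (g * g) * (s * p) = s * (p * (g * g) * p) * s := by
          rw [mul_assoc (s * p), hsp, ← hsp]; simp only [mul_assoc]; rw [hsp]
      _ = p * (s * y * s) := by
          rw [← hpy, ← mul_assoc, hsp]; simp only [mul_assoc]
      _ = p := by rw [hsys, mul_one]
  · have e : s * p * (b0 * p) * (s * p) - a =
        ((s - 1) * (b0 * p) * s + (b0 * p) * (s - 1)) - (a - b0 * p) := by
      have : s * p * (b0 * p) * (s * p) = s * (b0 * p) * s := by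
        rw [hsp]
        calc p * s * (b0 * p) * (p * s) = p * s * (b0 * (p * p)) * s := by simp only [mul_assoc]
          _ = s * (p * (b0 * p)) * s := by rw [hpp, ← hsp]; simp only [mul_assoc]
          _ = _ := by rw [hpb]
      rw [this]; noncomm_ring
    rw [e]
    have sn : ‖s‖ ≤ 2 := by
      have : s = (s - 1) + 1 := by abel
      rw [this]
      refine (norm_add_le _ _).trans ?_
      have := norm_one_le_one A
      linarith
    refine (norm_sub_le _ _).trans ?_
    have m1 : ‖(s - 1) * (b0 * p) * s‖ ≤ (2 * (η / 16)) * (3 / 2) * 2 := by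
      refine (norm_mul_le _ _).trans ?_
      gcongr
      refine (norm_mul_le _ _).trans ?_
      gcongr
    have m2 : ‖(b0 * p) * (s - 1)‖ ≤ (3 / 2) * (2 * (η / 16)) := by
      refine (norm_mul_le _ _).trans ?_
      gcongr
    have m3 := norm_add_le ((s - 1) * (b0 * p) * s) ((b0 * p) * (s - 1))
    linarith

end RR0


section OrderZero

/-- order zero condition for a linear map -/
def OrdZero {F A : Type*} [NonUnitalCStarAlgebra F] [NonUnitalCStarAlgebra A]
    (φ : F →ₗ[ℂ] A) : Prop :=
  ∀ x y : F, (∃ u, x = star u * u) → (∃ v, y = star v * v) → x * y = 0 → φ x * φ y = 0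

section
variable {F : Type u} {A : Type v} [NonUnitalCStarAlgebra F] [NonUnitalCStarAlgebra A]
  {φ : F →ₗ[ℂ] A} {z : F}

theorem cp_map_star (hφ : IsCP φ) (hz : ∀ x, x * z = x) (x : F) : φ (star x) = star (φ x) := by
  obtain ⟨a₁, a₂, b₁, b₂, p1, p2, p3, p4⟩ := hφ.decomp x z
  rw [hz] at p2
  rw [← star_mul, hz] at p3
  rw [p2, p3]; simp

theorem cp_claim (hφ : IsCP φ) (hz : ∀ x, x * z = x) (x : F) (S : A)
    (h : φ (x * star x) * S = 0) : star (φ x) * S = 0 := by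
  obtain ⟨a₁, a₂, b₁, b₂, p1, p2, p3, p4⟩ := hφ.decomp x z
  rw [hz] at p2
  have h2 : star (a₁ * S) * (a₁ * S) + star (a₂ * S) * (a₂ * S) = 0 := by
    have : star S * (φ (x * star x) * S) = 0 := by rw [h, mul_zero]
    rw [p1] at this
    rw [← this]
    simp only [star_mul, mul_add, add_mul, mul_assoc]
  obtain ⟨k1, k2⟩ := eq_zero_of_sq_add h2
  rw [p2]
  simp [add_mul, mul_assoc, k1, k2]

theorem ordZero_general (hφ : IsCP φ) (ho : OrdZero φ) (hz : ∀ x, x * z = x) {x y : F}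
    (h : star x * y = 0) : star (φ x) * φ y = 0 := by
  have hQP : φ (y * star y) * φ (x * star x) = 0 := by
    refine ho _ _ ⟨star y, by simp⟩ ⟨star x, by simp⟩ ?_
    have : star y * x = 0 := by simpa using congrArg star h
    rw [mul_assoc, ← mul_assoc (star y), this]; simp
  have h1 := cp_claim hφ hz y _ hQP
  refine cp_claim hφ hz x _ ?_
  have := congrArg star h1
  rw [star_mul, star_star, star_zero, ← cp_map_star hφ hz] at this
  simpa using this

theorem ordZero_rot (hφ : IsCP φ) (ho : OrdZero φ) (hz : ∀ x, x * z = x) {x₁ x₂ y₁ y₂ : F}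
    (h : star x₁ * y₁ = star x₂ * y₂) (h1 : star x₁ * y₂ = 0) (h2 : star x₂ * y₁ = 0) :
    star (φ x₁) * φ y₁ = star (φ x₂) * φ y₂ := by
  have k := ordZero_general hφ ho hz (x := x₁ + x₂) (y := y₁ - y₂) (by
    rw [star_add, add_mul, mul_sub, mul_sub, h1, h2, h]; simp)
  have k1 := ordZero_general hφ ho hz h1
  have k2 := ordZero_general hφ ho hz h2
  rw [map_add, map_sub, star_add, add_mul, mul_sub, mul_sub, k1, k2] at k
  rw [← sub_eq_zero, ← k]; abel

end

theorem exists_fd_of_isometries {A : Type*} [CStarAlgebra A] {n : ℕ} (c : Fin n → Fin n)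
    (W p : Fin n → A) (B : Fin n → NonUnitalStarSubalgebra ℂ A)
    (hfd : ∀ k, FiniteDimensional ℂ (B k)) (hp : ∀ k, ∀ x ∈ B k, p k * x = x)
    (hW : ∀ i l, star (W i) * W l = if i = l then p (c i) else 0) :
    ∃ C : NonUnitalStarSubalgebra ℂ A, FiniteDimensional ℂ C ∧
      ∀ i l, c i = c l → ∀ x ∈ B (c i), W i * x * star (W l) ∈ C := by
  let G : Set A := {y | ∃ i l, c i = c l ∧ ∃ x ∈ B (c i), y = W i * x * star (W l)}
  have hmul : ∀ y ∈ G, ∀ y' ∈ G, y * y' ∈ Submodule.span ℂ G := by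
    rintro _ ⟨i, l, hil, x, hx, rfl⟩ _ ⟨i', l', hil', x', hx', rfl⟩
    have e : W i * x * star (W l) * (W i' * x' * star (W l')) =
        W i * x * (star (W l) * W i') * x' * star (W l') := by simp only [mul_assoc]
    rw [e, hW]
    split_ifs with h
    · subst h
      have e2 : W i * x * p (c l) * x' * star (W l') = W i * (x * x') * star (W l') := by
        rw [mul_assoc (W i * x), hp _ _ hx']; simp only [mul_assoc]
      rw [e2]
      refine Submodule.subset_span ⟨i, l', hil.trans hil', _, mul_mem hx ?_, rfl⟩
      rwa [hil]
    · simp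
  let C : NonUnitalStarSubalgebra ℂ A :=
    { carrier := Submodule.span ℂ G
      zero_mem' := zero_mem _
      add_mem' := fun ha hb => add_mem ha hb
      smul_mem' := fun r _ hx => Submodule.smul_mem _ r hx
      mul_mem' := by
        intro a b ha hb
        refine Submodule.span_induction₂ (p := fun a b _ _ => a * b ∈ Submodule.span ℂ G)
          (fun a b ha hb => hmul a ha b hb) (by simp) (by simp)
          (fun x y z _ _ _ h1 h2 => by rw [add_mul]; exact add_mem h1 h2)
          (fun x y z _ _ _ h1 h2 => by rw [mul_add]; exact add_mem h1 h2)
          (fun r x y _ _ h => by rw [smul_mul_assoc]; exact Submodule.smul_mem _ _ h)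
          (fun r x y _ _ h => by rw [mul_smul_comm]; exact Submodule.smul_mem _ _ h) ha hb
      star_mem' := by
        intro a ha
        refine Submodule.span_induction (p := fun a _ => star a ∈ Submodule.span ℂ G)
          ?_ (by simp) (fun x y _ _ h1 h2 => by rw [star_add]; exact add_mem h1 h2)
          (fun r x _ h => by rw [star_smul]; exact Submodule.smul_mem _ _ h) ha
        rintro _ ⟨i, l, hil, x, hx, rfl⟩
        refine Submodule.subset_span ⟨l, i, hil.symm, star x, ?_, by simp [mul_assoc]⟩
        rw [← hil]; exact star_mem hx }
  refine ⟨C, ?_, fun i l hil x hx => Submodule.subset_span ⟨i, l, hil, x, hx, rfl⟩⟩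
  let f : Fin n → Fin n → A →ₗ[ℂ] A := fun i l =>
    (LinearMap.mulRight ℂ (star (W l))) ∘ₗ (LinearMap.mulLeft ℂ (W i))
  have hle : Submodule.span ℂ G ≤
      ⨆ il : Fin n × Fin n, ((B (c il.1)).toNonUnitalSubalgebra.toSubmodule).map (f il.1 il.2) := by
    rw [Submodule.span_le]
    rintro _ ⟨i, l, hil, x, hx, rfl⟩
    exact Submodule.mem_iSup_of_mem (i, l) ⟨x, hx, rfl⟩
  have : ∀ k, FiniteDimensional ℂ (B k).toNonUnitalSubalgebra.toSubmodule := hfd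
  exact Submodule.finiteDimensional_of_le hle

theorem ordZero_approx {F : Type u} {A : Type v} [NonUnitalCStarAlgebra F]
    [FiniteDimensional ℂ F] [CStarAlgebra A] (hrr : RealRankZero A) {φ : F →ₗ[ℂ] A}
    (hφ : IsCP φ) (hc : ∀ x, ‖φ x‖ ≤ ‖x‖) (ho : OrdZero φ) (Y : Finset F) {ε : ℝ} (hε : 0 < ε) :
    ∃ C : NonUnitalStarSubalgebra ℂ A, FiniteDimensional ℂ C ∧
      ∀ y ∈ Y, ∃ d ∈ C, ‖φ y - d‖ ≤ ε := by
  obtain ⟨n, c, V, hcc, hVsa, hVc, hVV, hVne, hunit, hspan⟩ := exists_matrix_units F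
  choose k hk0 hk using hspan
  -- the unit
  have hz : ∀ x, x * (∑ i, V i * star (V i)) = x := by
    intro x
    have := congrArg star (hunit (star x))
    rwa [star_mul, star_star, star_sum, Finset.sum_congr rfl
      (fun i _ => show star (V i * star (V i)) = V i * star (V i) by simp)] at this
  have φstar := cp_map_star hφ hz
  have rot : ∀ {x₁ x₂ y₁ y₂ : F}, star x₁ * y₁ = star x₂ * y₂ → star x₁ * y₂ = 0 →
    star x₂ * y₁ = 0 → star (φ x₁) * φ y₁ = star (φ x₂) * φ y₂ :=
    fun h h1 h2 => ordZero_rot hφ ho hz h h1 h2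
  have hself : ∀ i, star (V i) * V i = V (c i) := fun i => by simpa using hVV i i
  have hne : ∀ i l, i ≠ l → star (V i) * V l = 0 := fun i l h => by simpa [h] using hVV i l
  have hcV : ∀ i l, c i ≠ l → V (c i) * V l = 0 := fun i l h => by
    rw [← hVsa i]; exact hne _ _ h
  have hVVn : ∀ i l, c i ≠ l → V i * V l = 0 := fun i l h => by
    rw [← hVc i, mul_assoc, hcV i l h, mul_zero]
  have hcstar : ∀ i, V (c i) * star (V i) = star (V i) := fun i => by
    have := congrArg star (hVc i)
    rwa [star_mul, hVsa] at this
  have hcidem : ∀ i, V (c i) * V (c i) = V (c i) := fun i => by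
    have := hVc (c i); rwa [hcc] at this
  have hsaφ : ∀ i, star (φ (V (c i))) = φ (V (c i)) := fun i => by rw [← φstar, hVsa]
  have hAsa : ∀ i, star (φ (V i * star (V i))) = φ (V i * star (V i)) := fun i => by
    rw [← φstar]; simp
  -- F1
  have F1 : ∀ i l, star (φ (V i)) * φ (V l) = if i = l then φ (V (c i)) * φ (V (c i)) else 0 := by
    intro i l
    split_ifs with h
    · subst h
      by_cases h : i = c i
      · have := hsaφ i
        rw [← h] at this ⊢
        rw [this]
      · rw [rot (x₁ := V i) (y₁ := V i) (x₂ := V (c i)) (y₂ := V (c i))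
          (by rw [hself, hself, hcc]) (hne _ _ h) (hne _ _ (Ne.symm h)), hsaφ]
    · exact ordZero_general hφ ho hz (hne _ _ h)
  -- F2
  have F2 : ∀ i, φ (V i) * φ (V (c i)) = φ (V i * star (V i)) * φ (V i) := by
    intro i
    by_cases h : i = c i
    · have h1 := hVsa i
      have h2 := hcidem i
      rw [← h] at h1 h2 ⊢
      rw [h1, h2]
    · have := rot (x₁ := V i * star (V i)) (y₁ := V i) (x₂ := star (V i)) (y₂ := V (c i))
        (by rw [star_mul, star_star, mul_assoc, hself, hVc])
        (by rw [star_mul, star_star, mul_assoc, hne _ _ h, mul_zero])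
        (by rw [star_star]; exact hVVn i i (Ne.symm h))
      rw [hAsa, φstar, star_star] at this
      exact this.symm
  -- F3
  have F3 : ∀ i l, c i = c l → φ (V i) * star (φ (V l)) =
      φ (V i * star (V i)) * φ (V i * star (V l)) := by
    intro i l hil
    by_cases h : i = c i
    · have h1 := hVsa i
      have h2 := hcidem i
      have h3 := hcstar l
      rw [← hil] at h3
      rw [← h] at h1 h2 h3
      rw [h1, h2, h3, φstar]
    · have := rot (x₁ := star (V i)) (y₁ := star (V l)) (x₂ := V i * star (V i))
        (y₂ := V i * star (V l))
        (by
          rw [star_mul, star_star, mul_assoc (V i), ← mul_assoc (star (V i)), hself, hil,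
            hcstar])
        (by rw [star_star, ← mul_assoc, hVVn i i (Ne.symm h), zero_mul])
        (by
          rw [star_mul, star_star, mul_assoc, ← star_mul, hVVn l i (by rw [← hil]; exact Ne.symm h)]
          simp)
      rw [hAsa, φstar, φstar, star_star] at this
      exact this
  -- F4
  have F4 : ∀ i l, c i = c l → φ (V i * star (V l)) * star (φ (V i * star (V l))) =
      φ (V i * star (V i)) * φ (V i * star (V i)) := by
    intro i l hil
    by_cases h : i = l
    · subst h; rw [hAsa]
    · have := rot (x₁ := V l * star (V i)) (y₁ := V l * star (V i)) (x₂ := V i * star (V i))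
        (y₂ := V i * star (V i))
        (by
          rw [star_mul, star_star, mul_assoc, ← mul_assoc (star (V l)), hself, star_mul, star_star,
            mul_assoc (V i), ← mul_assoc (star (V i)), hself, hil])
        (by rw [star_mul, star_star, mul_assoc, ← mul_assoc (star (V l)), hne _ _ (Ne.symm h)]; simp)
        (by rw [star_mul, star_star, mul_assoc, ← mul_assoc (star (V i)), hne _ _ h]; simp)
      rw [hAsa] at this
      rw [← this, ← φstar, star_mul, star_star, ← φstar, star_mul, star_star]
  -- norms
  have hVcn : ∀ i, ‖V (c i)‖ ≤ 1 := by
    intro i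
    have := CStarRing.norm_star_mul_self (x := V (c i))
    rw [hself, hcc] at this
    nlinarith [norm_nonneg (V (c i))]
  have hacn : ∀ i, ‖φ (V (c i))‖ ≤ 1 := fun i => (hc _).trans (hVcn i)
  have hAn : ∀ i, ‖φ (V i * star (V i))‖ ≤ 1 := fun i => by
    refine (hc _).trans ?_
    rw [CStarRing.norm_self_mul_star, ← CStarRing.norm_star_mul_self, hself]
    exact hVcn i
  have hacp : ∀ i, ∃ y, φ (V (c i)) = star y * y := fun i => by
    have := hφ.pos (V i)
    rwa [hself] at this
  have hAp : ∀ i, ∃ y, φ (V i * star (V i)) = star y * y := fun i => by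
    have := hφ.pos (star (V i))
    rwa [star_star] at this
  -- constants
  let K : ℝ := ∑ y ∈ Y, ∑ i, ∑ l, ‖k y i l‖
  have hK0 : 0 ≤ K := by positivity
  obtain ⟨η, hη, hη1, hηK⟩ : ∃ η : ℝ, 0 < η ∧ η ≤ 1 ∧ K * (12 * η) ≤ ε := by
    refine ⟨min 1 (ε / (12 * (K + 1))), by positivity, min_le_left _ _, ?_⟩
    calc K * (12 * min 1 (ε / (12 * (K + 1)))) ≤ (K + 1) * (12 * (ε / (12 * (K + 1)))) := by
          gcongr
          · linarith
          · exact min_le_right _ _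
      _ = ε := by field_simp
  obtain ⟨N0, hN0⟩ := rr0_data hrr hη hη1
  obtain ⟨N1, hN1⟩ := exists_nat_gt (1 / η)
  set N := max N0 (max N1 1) with hN
  have hNpos : 0 < N := lt_of_lt_of_le Nat.one_pos ((le_max_right _ _).trans (le_max_right _ _))
  have hNη : 1 / (N : ℝ) ≤ η := by
    rw [div_le_iff₀ (by exact_mod_cast hNpos)]
    have h1 : (N1 : ℝ) ≤ N := by exact_mod_cast (le_max_left _ _).trans (le_max_right _ _)
    rw [div_lt_iff₀ hη] at hN1
    nlinarith
  have data := fun i => hN0 N (le_max_left _ _) (φ (V (c i))) (hacp i) (hacn i)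
  choose p s b B hBfd hpsa hps hssa hbB hpB hsgs hsbs using data
  let m : A → A := fun a => ∑ j ∈ Finset.range N, (1 - a) ^ j
  have hma : ∀ a : A, m a * a = 1 - (1 - a) ^ N := fun a => by
    have := geom_sum_mul_neg (1 - a) N
    rwa [sub_sub_cancel] at this
  have ham : ∀ a : A, a * m a = 1 - (1 - a) ^ N := fun a => by
    have := mul_neg_geom_sum (1 - a) N
    rwa [sub_sub_cancel] at this
  have hmsa : ∀ a : A, star a = a → star (m a) = m a := fun a ha => by
    simp [m, star_sum, star_pow, star_sub, ha]
  have hconj : ∀ {T a a' : A}, T * a = a' * T → T * m a = m a' * T := by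
    intro T a a' h
    have h1 : SemiconjBy T (1 - a) (1 - a') := by
      unfold SemiconjBy; rw [mul_sub, sub_mul, h, mul_one, one_mul]
    simp only [m, Finset.mul_sum, Finset.sum_mul]
    exact Finset.sum_congr rfl fun j _ => (h1.pow_right j)
  let U : Fin n → A := fun i => φ (V i) * m (φ (V (c i)))
  have hUU : ∀ i l, star (U i) * U l = if i = l then
      (1 - (1 - φ (V (c i))) ^ N) * (1 - (1 - φ (V (c i))) ^ N) else 0 := by
    intro i l
    have : star (U i) * U l = m (φ (V (c i))) * (star (φ (V i)) * φ (V l)) * m (φ (V (c l))) := by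
      simp only [U, star_mul, hmsa _ (hsaφ i), mul_assoc]
    rw [this, F1]
    split_ifs with h
    · subst h
      rw [← mul_assoc, hma, mul_assoc, ham]
    · simp
  have hgn : ∀ a : A, (∃ y, a = star y * y) → ‖a‖ ≤ 1 → ‖(1 - a) ^ N‖ ≤ 1 := fun a ha h1 =>
    (norm_pow_le' _ hNpos).trans (pow_le_one₀ (norm_nonneg _) (norm_one_sub_le_one ha h1))
  have hUn : ∀ i, ‖U i‖ ≤ 2 := by
    intro i
    have h1 := CStarRing.norm_star_mul_self (x := U i)
    rw [hUU, if_pos rfl] at h1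
    have h2 : ‖1 - (1 - φ (V (c i))) ^ N‖ ≤ 2 := by
      refine (norm_sub_le _ _).trans ?_
      have := hgn _ (hacp i) (hacn i)
      have := norm_one_le_one A
      linarith
    have h3 := norm_mul_le (1 - (1 - φ (V (c i))) ^ N) (1 - (1 - φ (V (c i))) ^ N)
    nlinarith [norm_nonneg (U i), norm_nonneg (1 - (1 - φ (V (c i))) ^ N)]
  let W : Fin n → A := fun i => U i * s (c i)
  have hWW : ∀ i l, star (W i) * W l = if i = l then p (c i) else 0 := by
    intro i l
    have : star (W i) * W l = s (c i) * (star (U i) * U l) * s (c l) := by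
      simp only [W, star_mul, hssa, mul_assoc]
    rw [this, hUU]
    split_ifs with h
    · subst h
      have := hsgs (c i)
      rwa [hcc] at this
    · simp
  obtain ⟨C, hCfd, hC⟩ := exists_fd_of_isometries c W p B hBfd hpB hWW
  refine ⟨C, hCfd, fun y hy => ?_⟩
  have err : ∀ i l, c i = c l →
      ‖φ (V i * star (V l)) - W i * b (c i) * star (W l)‖ ≤ 12 * η := by
    intro i l hil
    have e1 : W i * b (c i) * star (W l) = U i * (s (c i) * b (c i) * s (c i)) * star (U l) := by
      simp only [W, star_mul, hssa, ← hil, mul_assoc]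
    set a := φ (V (c i)) with ha
    set A' := φ (V i * star (V i)) with hA'
    set M := φ (V i * star (V l)) with hM
    have e2 : U i * a * star (U l) = (1 - (1 - A') ^ N) * (1 - (1 - A') ^ N) * M := by
      have hsemi : φ (V i) * a = A' * φ (V i) := F2 i
      have hm := hconj hsemi
      have : U i * a * star (U l) = φ (V i) * m a * a * m a * star (φ (V l)) := by
        have hma2 : star (m a) = m a := hmsa _ (hsaφ i)
        simp only [U, star_mul, ← hil, ← ha, hma2, mul_assoc]
      rw [this, hm, mul_assoc (m A'), hsemi, mul_assoc (m A'), mul_assoc A', hm,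
        mul_assoc (m A'), mul_assoc A', mul_assoc (m A'), F3 i l hil, ← hA', ← hM]
      rw [← mul_assoc (m A') A' M, hma, ← mul_assoc A', ← mul_assoc (m A'), ← mul_assoc (m A'),
        hma]
    have e3 : M - W i * b (c i) * star (W l) =
        (1 - (1 - (1 - A') ^ N) * (1 - (1 - A') ^ N)) * M -
          U i * (s (c i) * b (c i) * s (c i) - a) * star (U l) := by
      rw [e1, sub_mul, one_mul, ← e2, mul_sub, sub_mul]; abel
    rw [e3]
    have n1 : ‖U i * (s (c i) * b (c i) * s (c i) - a) * star (U l)‖ ≤ 2 * η * 2 := by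
      refine (norm_mul_le _ _).trans ?_
      rw [norm_star]
      have h1 : ‖s (c i) * b (c i) * s (c i) - a‖ ≤ η := by
        have := hsbs (c i)
        rwa [hcc] at this
      gcongr
      · refine (norm_mul_le _ _).trans ?_
        gcongr
        exact hUn i
      · exact hUn l
    have n2 : ‖(1 - (1 - (1 - A') ^ N) * (1 - (1 - A') ^ N)) * M‖ ≤ 3 * η := by
      set w := (1 - A') ^ N with hw
      set Q := 1 - (1 - w) * (1 - w) with hQ
      have hwsa : star w = w := by rw [hw, star_pow, star_sub, star_one, hAsa]
      have hQsa : star Q = Q := by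
        rw [hQ, star_sub, star_mul, star_sub, star_one, hwsa]
      have h1 : ‖Q * M‖ * ‖Q * M‖ = ‖Q * A'‖ * ‖Q * A'‖ := by
        rw [← CStarRing.norm_self_mul_star, ← CStarRing.norm_self_mul_star (x := Q * A')]
        congr 1
        rw [star_mul, star_mul, hAsa, mul_assoc, ← mul_assoc M, F4 i l hil, ← hA']
        simp only [mul_assoc]
      have h2 : ‖Q * M‖ = ‖Q * A'‖ :=
        (mul_self_inj_of_nonneg (norm_nonneg _) (norm_nonneg _)).1 h1
      rw [h2]
      have h3 : Q * A' = (1 + (1 - w)) * (w * A') := by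
        rw [hQ]; noncomm_ring
      rw [h3]
      refine (norm_mul_le _ _).trans ?_
      have h4 : ‖1 + (1 - w)‖ ≤ 3 := by
        refine (norm_add_le _ _).trans ?_
        have := norm_sub_le 1 w
        have := hgn _ (hAp i) (hAn i)
        have := norm_one_le_one A
        linarith
      have h5 := (norm_mul_one_sub_pow_le (hAp i) (hAn i) N hNpos).trans hNη
      gcongr
    refine (norm_sub_le _ _).trans ?_
    linarith
  refine ⟨∑ i, ∑ l, k y i l • (W i * b (c i) * star (W l)), ?_, ?_⟩
  · refine sum_mem fun i _ => sum_mem fun l _ => ?_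
    by_cases h : c i = c l
    · exact SMulMemClass.smul_mem _ (hC i l h _ (hbB (c i)))
    · rw [hk0 y i l h, zero_smul]; exact zero_mem _
  · have e : φ y - ∑ i, ∑ l, k y i l • (W i * b (c i) * star (W l)) =
        ∑ i, ∑ l, k y i l • (φ (V i * star (V l)) - W i * b (c i) * star (W l)) := by
      conv_lhs => rw [hk y]
      simp only [map_sum, map_smul, smul_sub, Finset.sum_sub_distrib]
      rw [← hk y]
    rw [e]
    have hle : ∑ i, ∑ l, ‖k y i l‖ ≤ K :=
      Finset.single_le_sum (f := fun y => ∑ i, ∑ l, ‖k y i l‖)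
        (fun y _ => by positivity) hy
    calc _ ≤ ∑ i, ∑ l, ‖k y i l‖ * (12 * η) := by
          refine (norm_sum_le _ _).trans (Finset.sum_le_sum fun i _ => ?_)
          refine (norm_sum_le _ _).trans (Finset.sum_le_sum fun l _ => ?_)
          rw [norm_smul]
          by_cases h : c i = c l
          · gcongr
            exact err i l h
          · rw [hk0 y i l h]; simp
      _ = (∑ i, ∑ l, ‖k y i l‖) * (12 * η) := by
          simp only [Finset.sum_mul]
      _ ≤ K * (12 * η) := by gcongr
      _ ≤ ε := hηK

end OrderZero


section Assembly

theorem isCP_single {n : ℕ} {F : Fin n → Type v} [∀ i, NonUnitalCStarAlgebra (F i)] (i : Fin n) :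
    IsCP (LinearMap.single ℂ F i) := by
  apply isCP_of_mul_star
  · intro x y
    simp [Pi.single_mul]
  · intro x
    ext j
    by_cases h : j = i
    · subst h; simp
    · simp [h]

theorem isCP_proj {n : ℕ} {F : Fin n → Type v} [∀ i, NonUnitalCStarAlgebra (F i)] (i : Fin n) :
    IsCP (LinearMap.proj i : (∀ i, F i) →ₗ[ℂ] F i) := by
  apply isCP_of_mul_star
  · intro x y; rfl
  · intro x; rfl

theorem step_lemma (A : Type u) [CStarAlgebra A]
    (hrr : RealRankZero A) (hnd : NuclearDimLE 1 A) (S : Finset A) {ε : ℝ} (hε : 0 < ε) :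
    ∃ (h : A) (C D : NonUnitalStarSubalgebra ℂ A),
      (∃ x : A, h = star x * x) ∧ ‖h‖ ≤ 1 ∧ FiniteDimensional ℂ C ∧ FiniteDimensional ℂ D ∧
      ∀ a ∈ S, ‖h * a - a * h‖ ≤ 4 * (Real.sqrt ε * (1 + ‖a‖)) ∧
        Metric.infDist (h * a) (C : Set A) ≤ 2 * (Real.sqrt ε * (1 + ‖a‖)) + ε ∧
        Metric.infDist ((1 - h) * a) (D : Set A) ≤
          ε * ‖a‖ + (2 * (Real.sqrt ε * (1 + ‖a‖)) + ε) := by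
  classical
  let X : Finset A := {1} ∪ S ∪ S.image star ∪ S.image (fun a => star a * a) ∪
    S.image (fun a => a * star a)
  obtain ⟨F, instF, hfd, ψ, φ, hψ, hψc, hφ, hφi, happ⟩ := hnd X ε hε
  let σ : ∀ i : Fin 2, F i →ₗ[ℂ] A := fun i => φ ∘ₗ LinearMap.single ℂ F i
  let τ : ∀ i : Fin 2, A →ₗ[ℂ] F i := fun i => (LinearMap.proj i : (∀ i, F i) →ₗ[ℂ] F i) ∘ₗ ψ
  have hσ : ∀ i, IsCP (σ i) := fun i => hφ.comp_linear (isCP_single i)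
  have hτ : ∀ i, IsCP (τ i) := fun i => (isCP_proj i).comp_linear hψ
  have hσc : ∀ i x, ‖σ i x‖ ≤ ‖x‖ := fun i x => (hφi i).1 x
  have hσo : ∀ i, OrdZero (σ i) := fun i => (hφi i).2
  have hτc : ∀ i a, ‖τ i a‖ ≤ ‖a‖ := fun i a => (norm_le_pi_norm (ψ a) i).trans (hψc a)
  let Φ : Fin 2 → (A →ₗ[ℂ] A) := fun i => σ i ∘ₗ τ i
  have hΦ : ∀ i, IsCP (Φ i) := fun i => (hσ i).comp_linear (hτ i)
  have hΦ1 : ∀ i, ‖Φ i 1‖ ≤ 1 := fun i =>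
    (hσc i _).trans ((hτc i _).trans (norm_one_le_one A))
  have hsum : ∀ x, φ (ψ x) = Φ 0 x + Φ 1 x := by
    intro x
    have : ψ x = Pi.single 0 (ψ x 0) + Pi.single 1 (ψ x 1) := by
      ext j
      fin_cases j <;> simp
    conv_lhs => rw [this, map_add]
    rfl
  have e : ∀ x ∈ X, ‖Φ 0 x + Φ 1 x - x‖ ≤ ε := by
    intro x hx
    rw [← hsum]
    exact (happ x hx).le
  have e' : ∀ x ∈ X, ‖Φ 1 x + Φ 0 x - x‖ ≤ ε := by
    intro x hx
    rw [add_comm]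
    exact e x hx
  have m1 : (1 : A) ∈ X := by simp [X]
  have m2 : ∀ a ∈ S, a ∈ X := fun a ha => by simp [X, ha]
  have m3 : ∀ a ∈ S, star a ∈ X := fun a ha => by
    simp only [X, Finset.mem_union, Finset.mem_image]
    exact Or.inl (Or.inl (Or.inr ⟨a, ha, rfl⟩))
  have m4 : ∀ a ∈ S, star a * a ∈ X := fun a ha => by
    simp only [X, Finset.mem_union, Finset.mem_image]
    exact Or.inl (Or.inr ⟨a, ha, rfl⟩)
  have m5 : ∀ a ∈ S, a * star a ∈ X := fun a ha => by
    simp only [X, Finset.mem_union, Finset.mem_image]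
    exact Or.inr ⟨a, ha, rfl⟩
  have hC : ∀ i, ∃ C : NonUnitalStarSubalgebra ℂ A, FiniteDimensional ℂ C ∧
      ∀ y ∈ S.image (τ i), ∃ d ∈ C, ‖σ i y - d‖ ≤ ε := fun i =>
    haveI := hfd i
    ordZero_approx hrr (hσ i) (hσc i) (hσo i) _ hε
  choose C hCfd hC using hC
  have hdist : ∀ i (z : A), ∀ a ∈ S,
      Metric.infDist z (C i : Set A) ≤ ‖z - Φ i a‖ + ε := by
    intro i z a ha
    obtain ⟨d, hd, hd2⟩ := hC i (τ i a) (Finset.mem_image_of_mem _ ha)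
    refine (Metric.infDist_le_dist_of_mem (show d ∈ (C i : Set A) from hd)).trans ?_
    rw [dist_eq_norm]
    calc ‖z - d‖ = ‖(z - Φ i a) + (Φ i a - d)‖ := by congr 1; abel
      _ ≤ ‖z - Φ i a‖ + ‖Φ i a - d‖ := norm_add_le _ _
      _ ≤ _ := by gcongr; exact hd2
  refine ⟨Φ 0 1, C 0, C 1, ?_, hΦ1 0, hCfd 0, hCfd 1, fun a ha => ⟨?_, ?_, ?_⟩⟩
  · have := (hΦ 0).pos 1
    simpa using this
  · exact schwarz_approx_comm (hΦ 0) (hΦ 1) (hΦ1 0) a (e _ m1) (e _ (m2 a ha)) (e _ (m3 a ha))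
      (e _ (m4 a ha)) (e _ (m5 a ha))
  · refine (hdist 0 _ a ha).trans ?_
    gcongr
    exact schwarz_approx (hΦ 0) (hΦ 1) (hΦ1 0) a (e _ m1) (e _ (m2 a ha)) (e _ (m3 a ha))
      (e _ (m4 a ha))
  · refine (hdist 1 _ a ha).trans ?_
    rw [← add_assoc]
    gcongr
    have k := schwarz_approx (hΦ 1) (hΦ 0) (hΦ1 1) a (e' _ m1) (e' _ (m2 a ha)) (e' _ (m3 a ha))
      (e' _ (m4 a ha))
    calc ‖(1 - Φ 0 1) * a - Φ 1 a‖
        = ‖-((Φ 0 1 + Φ 1 1 - 1) * a) + (Φ 1 1 * a - Φ 1 a)‖ := by congr 1; noncomm_ring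
      _ ≤ ‖-((Φ 0 1 + Φ 1 1 - 1) * a)‖ + ‖Φ 1 1 * a - Φ 1 a‖ := norm_add_le _ _
      _ ≤ _ := by
        rw [norm_neg]
        gcongr
        refine (norm_mul_le _ _).trans ?_
        gcongr
        exact e _ m1

/-- uniformly Lipschitz nonnegative functions tending to zero on a dense sequence -/
theorem tendsto_of_dense {A : Type u} [CStarAlgebra A] (d : ℕ → A) (hd : DenseRange d)
    (f : ℕ → A → ℝ) (h0 : ∀ n a, 0 ≤ f n a) (hL : ∀ n a b, f n a ≤ f n b + 2 * ‖a - b‖)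
    (hf : ∀ k, Tendsto (fun n => f n (d k)) atTop (𝓝 0)) (a : A) :
    Tendsto (fun n => f n a) atTop (𝓝 0) := by
  rw [Metric.tendsto_atTop]
  intro ε hε
  obtain ⟨k, hk⟩ := hd.exists_dist_lt a (show 0 < ε / 4 by positivity)
  obtain ⟨N, hN⟩ := (Metric.tendsto_atTop.1 (hf k)) (ε / 2) (by positivity)
  refine ⟨N, fun n hn => ?_⟩
  have h1 := hN n hn
  have h2 := hL n a (d k)
  rw [Real.dist_eq, sub_zero, abs_of_nonneg (h0 _ _)] at h1 ⊢
  rw [dist_eq_norm] at hk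
  linarith

theorem final_thm
    (A : Type u) [CStarAlgebra A] [TopologicalSpace.SeparableSpace A]
    (hrr : RealRankZero A) (hnd : NuclearDimLE 1 A) :
    ∃ h : ℕ → A,
      (∀ n, (∃ x : A, h n = star x * x) ∧ ‖h n‖ ≤ 1) ∧
      (∀ a : A, Tendsto (fun n => ‖h n * a - a * h n‖) atTop (𝓝 0)) ∧
      ∃ C D : ℕ → NonUnitalStarSubalgebra ℂ A,
        (∀ n, FiniteDimensional ℂ (C n)) ∧ (∀ n, FiniteDimensional ℂ (D n)) ∧
        (∀ a : A, Tendsto (fun n => Metric.infDist (h n * a) (C n : Set A)) atTop (𝓝 0)) ∧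
        (∀ a : A, Tendsto (fun n => Metric.infDist ((1 - h n) * a) (D n : Set A)) atTop (𝓝 0)) := by
  classical
  let d : ℕ → A := TopologicalSpace.denseSeq A
  have hd : DenseRange d := TopologicalSpace.denseRange_denseSeq A
  let ε : ℕ → ℝ := fun n => 1 / ((n : ℝ) + 1)
  have hε : ∀ n, 0 < ε n := fun n => by positivity
  have hε0 : Tendsto ε atTop (𝓝 0) := tendsto_one_div_add_atTop_nhds_zero_nat
  have hs0 : Tendsto (fun n => Real.sqrt (ε n)) atTop (𝓝 0) := by
    have := (Real.continuous_sqrt.tendsto 0).comp hε0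
    rwa [Real.sqrt_zero] at this
  choose h C D hpos hnorm hCfd hDfd hS using fun n =>
    step_lemma A hrr hnd ((Finset.range (n + 1)).image d) (hε n)
  have hmem : ∀ k n, k ≤ n → d k ∈ (Finset.range (n + 1)).image d := fun k n hkn =>
    Finset.mem_image_of_mem _ (Finset.mem_range.2 (by omega))
  have lim2 : ∀ c : ℝ, Tendsto (fun n => 2 * (Real.sqrt (ε n) * (1 + c)) + ε n) atTop (𝓝 0) := by
    intro c
    have := ((hs0.mul_const (1 + c)).const_mul 2).add hε0
    simpa using this
  have hlip : ∀ (x a b : A), ‖x‖ ≤ 2 → ‖x * a - x * b‖ ≤ 2 * ‖a - b‖ := by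
    intro x a b hx
    rw [← mul_sub]
    refine (norm_mul_le _ _).trans ?_
    gcongr
  refine ⟨h, fun n => ⟨hpos n, hnorm n⟩, ?_, C, D, hCfd, hDfd, ?_, ?_⟩
  · refine tendsto_of_dense d hd (fun n a => ‖h n * a - a * h n‖) (fun n a => norm_nonneg _) ?_ ?_
    · intro n a b
      have : h n * a - a * h n = (h n * b - b * h n) + (h n * (a - b) - (a - b) * h n) := by
        noncomm_ring
      rw [this]
      refine (norm_add_le _ _).trans ?_
      gcongr
      refine (norm_sub_le _ _).trans ?_
      have h1 := norm_mul_le (h n) (a - b)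
      have h2 := norm_mul_le (a - b) (h n)
      nlinarith [norm_nonneg (a - b), hnorm n]
    · intro k
      have l : Tendsto (fun n => 4 * (Real.sqrt (ε n) * (1 + ‖d k‖))) atTop (𝓝 0) := by
        have := (hs0.mul_const (1 + ‖d k‖)).const_mul 4
        simpa using this
      refine squeeze_zero' (Eventually.of_forall fun n => norm_nonneg _) ?_ l
      filter_upwards [eventually_ge_atTop k] with n hn
      exact (hS n _ (hmem k n hn)).1
  · refine tendsto_of_dense d hd (fun n a => Metric.infDist (h n * a) (C n : Set A))
      (fun n a => Metric.infDist_nonneg) ?_ ?_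
    · intro n a b
      refine (Metric.infDist_le_infDist_add_dist (y := h n * b)).trans ?_
      rw [dist_eq_norm]
      gcongr
      exact hlip _ _ _ ((hnorm n).trans one_le_two)
    · intro k
      refine squeeze_zero' (Eventually.of_forall fun n => Metric.infDist_nonneg) ?_ (lim2 ‖d k‖)
      filter_upwards [eventually_ge_atTop k] with n hn
      exact (hS n _ (hmem k n hn)).2.1
  · refine tendsto_of_dense d hd (fun n a => Metric.infDist ((1 - h n) * a) (D n : Set A))
      (fun n a => Metric.infDist_nonneg) ?_ ?_
    · intro n a b
      refine (Metric.infDist_le_infDist_add_dist (y := (1 - h n) * b)).trans ?_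
      rw [dist_eq_norm]
      gcongr
      refine hlip _ _ _ ((norm_sub_le _ _).trans ?_)
      linarith [norm_one_le_one A, hnorm n]
    · intro k
      have l : Tendsto (fun n => ε n * ‖d k‖ + (2 * (Real.sqrt (ε n) * (1 + ‖d k‖)) + ε n))
          atTop (𝓝 0) := by
        have := (hε0.mul_const ‖d k‖).add (lim2 ‖d k‖)
        simpa using this
      refine squeeze_zero' (Eventually.of_forall fun n => Metric.infDist_nonneg) ?_ l
      filter_upwards [eventually_ge_atTop k] with n hn
      exact (hS n _ (hmem k n hn)).2.2

end Assembly

/-- Proposition 3.6 of the paper.  Let `A` be a separable, unital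
C*-algebra with real rank zero and nuclear dimension at most one.  Then there exists a
positive contraction `h ∈ A_∞ ∩ A'` and sequences `(C_n)`, `(D_n)` of finite-dimensional
C*-subalgebras of `A` such that `h·a ∈ C_∞` and `(1-h)·a ∈ D_∞` for all `a ∈ A`.

Here `A_∞ = (∏_ℕ A)/(⊕_ℕ A)` is the sequence algebra.  We formalize the statement at the
level of representing sequences: a positive contraction of `A_∞` is (the class of) a
sequence `(h_n)` of positive contractions of `A`; membership in `A_∞ ∩ A'` says exactly that
`‖[h_n, a]‖ → 0` for every `a ∈ A`; and `h·a ∈ C_∞` (resp. `(1-h)·a ∈ D_∞`) says exactly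
that the distance of `h_n·a` to `C_n` (resp. of `(1-h_n)·a` to `D_n`) tends to `0`. -/
theorem exists_sequence_decomposition_of_rr0_nucdim_one
    (A : Type u) [CStarAlgebra A] [TopologicalSpace.SeparableSpace A]
    (hrr : RealRankZero A) (hnd : NuclearDimLE 1 A) :
    ∃ h : ℕ → A,
      (∀ n, (∃ x : A, h n = star x * x) ∧ ‖h n‖ ≤ 1) ∧
      (∀ a : A, Tendsto (fun n => ‖h n * a - a * h n‖) atTop (𝓝 0)) ∧
      ∃ C D : ℕ → NonUnitalStarSubalgebra ℂ A,
        (∀ n, FiniteDimensional ℂ (C n)) ∧ (∀ n, FiniteDimensional ℂ (D n)) ∧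
        (∀ a : A, Tendsto (fun n => Metric.infDist (h n * a) (C n : Set A)) atTop (𝓝 0)) ∧
        (∀ a : A, Tendsto (fun n => Metric.infDist ((1 - h n) * a) (D n : Set A)) atTop (𝓝 0)) := by
  exact final_thm A hrr hnd
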